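/- Let a be a positive integer, m a non-negative integer and p a prime such that gcd(a, p^m) = 1 and a² + p^(2m) is not a perfect square. Suppose the negative Pell equation x² − (a² + p^(2m))·y² = −1 has a solution in integers x, y. Then there are at most two pairs (X, Y) of positive integers with gcd(X, Y) = 1 satisfying X² − (a² + p^(2m))·Y⁴ = −p^(2m). -/

import Mathlib

section Pade

open Finset

/-- Scaled coefficients of the Padé approximants to the fourth root. -/
noncomputable def padeCoeff (i j : ℕ) : ℝ :=
  4 ^ (i + j) * Ring.choose ((i + j : ℕ) + 1 / 4 : ℝ) i * Ring.choose ((i + j : ℕ) - 1 / 4 : ℝ) j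

theorem succ_mul_ringChoose_succ (x : ℝ) (k : ℕ) :
    (k + 1) * Ring.choose x (k + 1) = (x - k) * Ring.choose x k := by
  have h := Ring.choose_smul_choose x (Nat.le_succ k)
  rw [Nat.succ_eq_add_one, Nat.choose_succ_self_right, Nat.add_sub_cancel_left,
    Ring.choose_one_right, nsmul_eq_mul] at h
  push_cast at h
  linarith

theorem succ_mul_ringChoose_succ' (x : ℝ) (k : ℕ) :
    (k + 1) * Ring.choose x (k + 1) = x * Ring.choose (x - 1) k := by
  have h := Ring.choose_smul_choose x (Nat.le_add_left 1 k)
  rw [Nat.choose_one_right, Ring.choose_one_right, Nat.add_sub_cancel, nsmul_eq_mul] at h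
  push_cast at h
  exact h

theorem mul_ringChoose_sub_one (x : ℝ) (k : ℕ) :
    (x - k) * Ring.choose x k = x * Ring.choose (x - 1) k := by
  rw [← succ_mul_ringChoose_succ, succ_mul_ringChoose_succ']

theorem padeCoeff_zero : padeCoeff 0 0 = 1 := by simp [padeCoeff]

theorem padeCoeff_succ_left (i j : ℕ) :
    padeCoeff (i + 1) j * ((i + 1) * (4 * i + 3)) =
      (16 * ((i + j : ℕ) + 1 : ℝ) ^ 2 - 1) * padeCoeff i j := by
  have h1 := succ_mul_ringChoose_succ' ((i + 1 + j : ℕ) + 1 / 4 : ℝ) i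
  have h2 := mul_ringChoose_sub_one ((i + 1 + j : ℕ) - 1 / 4 : ℝ) j
  have e1 : ((i + 1 + j : ℕ) + 1 / 4 : ℝ) - 1 = (i + j : ℕ) + 1 / 4 := by push_cast; ring
  have e2 : ((i + 1 + j : ℕ) - 1 / 4 : ℝ) - 1 = (i + j : ℕ) - 1 / 4 := by push_cast; ring
  rw [e1] at h1
  rw [e2] at h2
  unfold padeCoeff
  have e3 : i + 1 + j = i + j + 1 := by ring
  rw [e3] at h1 h2 ⊢
  set A := Ring.choose ((i + j + 1 : ℕ) + 1 / 4 : ℝ) (i + 1)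
  set B := Ring.choose ((i + j + 1 : ℕ) - 1 / 4 : ℝ) j
  set A' := Ring.choose ((i + j : ℕ) + 1 / 4 : ℝ) i
  set B' := Ring.choose ((i + j : ℕ) - 1 / 4 : ℝ) j
  rw [pow_succ]
  push_cast at h1 h2 ⊢
  linear_combination (4 : ℝ) ^ (i + j) * (16 * ((i + 3 / 4) * B * h1 + (i + j + 1 + 1 / 4) * A' * h2))

theorem padeCoeff_succ_right (i j : ℕ) :
    padeCoeff i (j + 1) * ((j + 1) * (4 * j + 5)) =
      (16 * ((i + j : ℕ) + 1 : ℝ) ^ 2 - 1) * padeCoeff i j := by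
  have h1 := succ_mul_ringChoose_succ' ((i + (j + 1) : ℕ) - 1 / 4 : ℝ) j
  have h2 := mul_ringChoose_sub_one ((i + (j + 1) : ℕ) + 1 / 4 : ℝ) i
  have e1 : ((i + (j + 1) : ℕ) + 1 / 4 : ℝ) - 1 = (i + j : ℕ) + 1 / 4 := by push_cast; ring
  have e2 : ((i + (j + 1) : ℕ) - 1 / 4 : ℝ) - 1 = (i + j : ℕ) - 1 / 4 := by push_cast; ring
  rw [e2] at h1
  rw [e1] at h2
  unfold padeCoeff
  rw [← add_assoc] at h1 h2 ⊢
  set A := Ring.choose ((i + j + 1 : ℕ) + 1 / 4 : ℝ) i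
  set B := Ring.choose ((i + j + 1 : ℕ) - 1 / 4 : ℝ) (j + 1)
  set A' := Ring.choose ((i + j : ℕ) + 1 / 4 : ℝ) i
  set B' := Ring.choose ((i + j : ℕ) - 1 / 4 : ℝ) j
  rw [pow_succ]
  push_cast at h1 h2 ⊢
  linear_combination (4 : ℝ) ^ (i + j) * (16 * ((j + 5 / 4) * A * h1 + (i + j + 1 - 1 / 4) * B' * h2))

theorem padeCoeff_pos (i j : ℕ) : 0 < padeCoeff i j := by
  induction i with
  | zero =>
    induction j with
    | zero => simp [padeCoeff_zero]
    | succ j ih =>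
      have h := padeCoeff_succ_right 0 j
      have : 0 < padeCoeff 0 (j + 1) * ((j + 1 : ℝ) * (4 * j + 5)) := by
        rw [h]; apply mul_pos _ ih
        have : (0 : ℝ) ≤ (0 + j : ℕ) := Nat.cast_nonneg _
        nlinarith
      exact pos_of_mul_pos_left this (by positivity)
  | succ i ih =>
    have h := padeCoeff_succ_left i j
    have : 0 < padeCoeff (i + 1) j * ((i + 1 : ℝ) * (4 * i + 3)) := by
      rw [h]; apply mul_pos _ ih
      have : (0 : ℝ) ≤ (i + j : ℕ) := Nat.cast_nonneg _
      nlinarith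
    exact pos_of_mul_pos_left this (by positivity)

theorem sum_padeCoeff (r : ℕ) :
    ∑ ij ∈ antidiagonal r, padeCoeff ij.1 ij.2 = 4 ^ r * (2 * r).choose r := by
  have h := Ring.add_choose_eq r (Commute.all ((r : ℝ) + 1 / 4) ((r : ℝ) - 1 / 4))
  have e : (r : ℝ) + 1 / 4 + (r - 1 / 4) = (2 * r : ℕ) := by push_cast; ring
  rw [e, Ring.choose_natCast] at h
  rw [h, mul_sum]
  refine sum_congr rfl fun ij hij => ?_
  rw [HasAntidiagonal.mem_antidiagonal] at hij
  simp only [padeCoeff, hij]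
  ring

/-- A power series with constant term `1` whose square is `1` modulo `4` is `1` modulo `2`. -/
theorem even_coeff_of_sq {u : ℕ → ℝ} (h0 : u 0 = 1)
    (h : ∀ j, ∃ z : ℤ, ∑ ij ∈ antidiagonal (j + 1), u ij.1 * u ij.2 = 4 * z) (j : ℕ) :
    ∃ z : ℤ, u (j + 1) = 2 * z := by
  induction j using Nat.strong_induction_on with
  | _ j ih =>
    obtain ⟨z, hz⟩ := h j
    have hs : ∃ w : ℤ, ∑ ij ∈ antidiagonal (j + 1), u ij.1 * u ij.2 = 2 * u (j + 1) + 4 * w := by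
      cases j with
      | zero => exact ⟨0, by simp [Nat.antidiagonal_succ, h0]; ring⟩
      | succ j =>
        rw [Nat.sum_antidiagonal_succ, Nat.sum_antidiagonal_succ']
        have : ∃ w : ℤ, ∑ p ∈ antidiagonal j, u (p.1 + 1) * u (p.2 + 1) = 4 * w := by
          have key : ∀ p ∈ antidiagonal j, ∃ w : ℤ, u (p.1 + 1) * u (p.2 + 1) = 4 * w := by
            intro p hp
            rw [HasAntidiagonal.mem_antidiagonal] at hp
            obtain ⟨a, ha⟩ := ih p.1 (by omega)
            obtain ⟨b, hb⟩ := ih p.2 (by omega)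
            exact ⟨a * b, by rw [ha, hb]; push_cast; ring⟩
          choose! w hw using key
          exact ⟨∑ p ∈ antidiagonal j, w p, by rw [sum_congr rfl hw]; push_cast; rw [mul_sum]⟩
        obtain ⟨w, hw⟩ := this
        exact ⟨w, by rw [hw, h0]; ring⟩
    obtain ⟨w, hw⟩ := hs
    exact ⟨z - w, by push_cast; linarith⟩

theorem sum_antidiagonal_choose_mul (c x : ℝ) (j : ℕ) :
    ∑ ij ∈ antidiagonal j, (c ^ ij.1 * Ring.choose x ij.1) * (c ^ ij.2 * Ring.choose x ij.2) =
      c ^ j * Ring.choose (x + x) j := by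
  rw [Ring.add_choose_eq j (Commute.all x x), mul_sum]
  refine sum_congr rfl fun ij hij => ?_
  rw [HasAntidiagonal.mem_antidiagonal] at hij
  rw [← hij, pow_add]; ring

theorem eight_pow_mul_choose_int (r j : ℕ) :
    ∃ z : ℤ, (8 : ℝ) ^ j * Ring.choose ((r : ℝ) + 1 / 4) j = z := by
  have hs : ∀ j, ∃ z : ℤ, (4 : ℝ) ^ (j + 1) * Ring.choose (1 / 2 : ℝ) (j + 1) = 2 * z := by
    refine even_coeff_of_sq (u := fun j => (4 : ℝ) ^ j * Ring.choose (1 / 2 : ℝ) j) (by simp) ?_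
    intro j
    rw [sum_antidiagonal_choose_mul]
    have e : (1 / 2 + 1 / 2 : ℝ) = (1 : ℕ) := by norm_num
    rw [e, Ring.choose_natCast]
    exact ⟨4 ^ j * Nat.choose 1 (j + 1), by push_cast; ring⟩
  have he : ∀ j, ∃ z : ℤ, (8 : ℝ) ^ (j + 1) * Ring.choose (1 / 4 : ℝ) (j + 1) = 2 * z := by
    refine even_coeff_of_sq (u := fun j => (8 : ℝ) ^ j * Ring.choose (1 / 4 : ℝ) j) (by simp) ?_
    intro j
    rw [sum_antidiagonal_choose_mul]
    obtain ⟨z, hz⟩ := hs j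
    refine ⟨2 ^ j * z, ?_⟩
    have e : (1 / 4 + 1 / 4 : ℝ) = 1 / 2 := by norm_num
    rw [e, show (8 : ℝ) = 2 * 4 by norm_num, mul_pow, mul_assoc, hz]
    push_cast; ring
  induction r generalizing j with
  | zero =>
    cases j with
    | zero => exact ⟨1, by simp⟩
    | succ j =>
      obtain ⟨z, hz⟩ := he j
      exact ⟨2 * z, by push_cast; rw [zero_add, hz]⟩
  | succ r ih =>
    cases j with
    | zero => exact ⟨1, by simp⟩
    | succ j =>
      obtain ⟨z, hz⟩ := ih j
      obtain ⟨w, hw⟩ := ih (j + 1)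
      refine ⟨8 * z + w, ?_⟩
      have e : ((r + 1 : ℕ) : ℝ) + 1 / 4 = (r + 1 / 4) + 1 := by push_cast; ring
      rw [e, Ring.choose_succ_succ]
      push_cast
      rw [← hz, ← hw]; ring

/-- The Padé polynomials. -/
noncomputable def padePoly (r : ℕ) (x y : ℂ) : ℂ :=
  ∑ ij ∈ antidiagonal r, (padeCoeff ij.1 ij.2 : ℂ) * x ^ ij.2 * y ^ ij.1

theorem sum_ringChoose_mul_choose (r k : ℕ) (hk : k ≤ r) (x y : ℝ) :
    ∑ i ∈ range (r + 1), Ring.choose x i * Ring.choose y (r - i) * (i.choose k) =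
      Ring.choose x k * Ring.choose (x - k + y) (r - k) := by
  rw [Ring.add_choose_eq _ (Commute.all _ _), Nat.sum_antidiagonal_eq_sum_range_succ_mk,
    ← sum_range_add_sum_Ico _ (show k ≤ r + 1 by omega), sum_Ico_eq_sum_range, mul_sum]
  rw [sum_eq_zero, zero_add]
  · have : r + 1 - k = (r - k).succ := by omega
    rw [this]
    refine sum_congr rfl fun i hi => ?_
    rw [mem_range] at hi
    have h := Ring.choose_smul_choose x (Nat.le_add_right k i)
    rw [nsmul_eq_mul, Nat.add_sub_cancel_left] at h
    simp only
    rw [← mul_assoc, ← h, show r - (k + i) = r - k - i by omega]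
    ring
  · intro i hi
    rw [mem_range] at hi
    simp [Nat.choose_eq_zero_of_lt hi]

theorem padePoly_eq (r : ℕ) (x d : ℂ) :
    padePoly r x (x - d) = ∑ k ∈ range (r + 1),
      ((4 ^ r * Ring.choose ((r : ℝ) + 1 / 4) k : ℝ) : ℂ) * ((2 * r - k).choose (r - k) : ℕ) *
        (-d) ^ k * x ^ (r - k) := by
  unfold padePoly
  rw [Nat.sum_antidiagonal_eq_sum_range_succ_mk]
  have h1 : ∀ i ∈ range r.succ, (padeCoeff i (r - i) : ℂ) * x ^ (r - i) * (x - d) ^ i =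
      ∑ k ∈ range (r + 1), ((4 ^ r : ℝ) : ℂ) * ((Ring.choose ((r : ℝ) + 1 / 4) i *
        Ring.choose ((r : ℝ) - 1 / 4) (r - i) * (i.choose k) : ℝ) : ℂ) * ((-d) ^ k * x ^ (r - k)) := by
    intro i hi
    have hi' : i ≤ r := by rw [mem_range] at hi; omega
    have e : x - d = -d + x := by ring
    rw [e, add_pow]
    rw [mul_sum]
    have hsub : range (i + 1) ⊆ range (r + 1) := range_subset_range.mpr (by omega)
    rw [← sum_subset hsub]
    · refine sum_congr rfl fun k hk => ?_
      rw [mem_range] at hk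
      have e2 : r - k = (r - i) + (i - k) := by omega
      have e3 : i + (r - i) = r := by omega
      rw [e2, pow_add, padeCoeff, e3]
      push_cast
      ring
    · intro k _ hk
      have : i < k := by simpa using hk
      simp [Nat.choose_eq_zero_of_lt this]
  rw [sum_congr rfl h1, sum_comm]
  refine sum_congr rfl fun k hk => ?_
  have hk' : k ≤ r := by rw [mem_range] at hk; omega
  rw [← sum_mul, ← mul_sum, ← Complex.ofReal_sum, sum_ringChoose_mul_choose r k hk']
  have e : (r : ℝ) + 1 / 4 - k + (r - 1 / 4) = (2 * r - k : ℕ) := by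
    rw [Nat.cast_sub (by omega)]; push_cast; ring
  rw [e, Ring.choose_natCast]
  push_cast
  ring

theorem padePoly_mem_range (r : ℕ) (z : GaussianInt) :
    padePoly r (GaussianInt.toComplex z) (GaussianInt.toComplex (star z)) ∈
      GaussianInt.toComplex.range := by
  have e : GaussianInt.toComplex (star z) =
      GaussianInt.toComplex z - (2 * GaussianInt.toComplex ⟨0, z.im⟩) := by
    simp only [GaussianInt.toComplex_def]
    simp
    ring
  rw [e, padePoly_eq]
  refine Subring.sum_mem _ fun k hk => ?_
  have hk' : k ≤ r := by rw [mem_range] at hk; omega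
  obtain ⟨w, hw⟩ := eight_pow_mul_choose_int r k
  have e2 : ((4 ^ r * Ring.choose ((r : ℝ) + 1 / 4) k : ℝ) : ℂ) * 2 ^ k = 4 ^ (r - k) * (w : ℂ) := by
    have : (4 : ℝ) ^ r * Ring.choose ((r : ℝ) + 1 / 4) k * 2 ^ k = 4 ^ (r - k) * w := by
      rw [← hw]
      obtain ⟨s, rfl⟩ := Nat.exists_eq_add_of_le hk'
      rw [Nat.add_sub_cancel_left, pow_add, show (8 : ℝ) = 4 * 2 by norm_num, mul_pow]
      ring
    exact_mod_cast this
  have e3 : ((4 ^ r * Ring.choose ((r : ℝ) + 1 / 4) k : ℝ) : ℂ) *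
      ((2 * r - k).choose (r - k) : ℕ) * (-(2 * GaussianInt.toComplex ⟨0, z.im⟩)) ^ k *
        GaussianInt.toComplex z ^ (r - k) =
      GaussianInt.toComplex (4 ^ (r - k) * (w : GaussianInt) * ((2 * r - k).choose (r - k) : ℕ) *
        (-⟨0, z.im⟩) ^ k * z ^ (r - k)) := by
    simp only [map_mul, map_pow, map_neg, map_natCast, map_intCast, map_ofNat]
    rw [← e2, ← mul_neg, mul_pow]
    ring
  rw [e3]
  exact ⟨_, rfl⟩

/-- The imaginary part of the Padé remainder on the unit circle. -/
noncomputable def padeSin (r : ℕ) (x : ℝ) : ℝ :=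
  ∑ ij ∈ antidiagonal r, padeCoeff ij.1 ij.2 * Real.sin ((ij.2 - ij.1 + 1 / 4) * x)

/-- The real part of the Padé remainder on the unit circle. -/
noncomputable def padeCos (r : ℕ) (x : ℝ) : ℝ :=
  ∑ ij ∈ antidiagonal r, padeCoeff ij.1 ij.2 * Real.cos ((ij.2 - ij.1 + 1 / 4) * x)

theorem padeCoeff_weighted_sum (r : ℕ) (F : ℕ → ℕ → ℝ) :
    4 * (r + 1) * ∑ ij ∈ antidiagonal (r + 1),
        padeCoeff ij.1 ij.2 * ((ij.2 - ij.1 + 1 / 4) * F ij.1 ij.2) =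
      (16 * ((r : ℝ) + 1) ^ 2 - 1) * ∑ ij ∈ antidiagonal r,
        padeCoeff ij.1 ij.2 * (F ij.1 (ij.2 + 1) - F (ij.1 + 1) ij.2) := by
  have h1 : ∑ ij ∈ antidiagonal (r + 1),
      padeCoeff ij.1 ij.2 * (ij.2 * (4 * ij.2 + 1)) * F ij.1 ij.2 =
      ∑ ij ∈ antidiagonal r, (16 * ((r : ℝ) + 1) ^ 2 - 1) * padeCoeff ij.1 ij.2 *
        F ij.1 (ij.2 + 1) := by
    rw [Nat.sum_antidiagonal_succ']
    simp only [Nat.cast_zero, zero_mul, mul_zero, zero_add]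
    refine sum_congr rfl fun ij hij => ?_
    rw [HasAntidiagonal.mem_antidiagonal] at hij
    rw [← hij, ← padeCoeff_succ_right]
    push_cast; ring
  have h2 : ∑ ij ∈ antidiagonal (r + 1),
      padeCoeff ij.1 ij.2 * (ij.1 * (4 * ij.1 - 1)) * F ij.1 ij.2 =
      ∑ ij ∈ antidiagonal r, (16 * ((r : ℝ) + 1) ^ 2 - 1) * padeCoeff ij.1 ij.2 *
        F (ij.1 + 1) ij.2 := by
    rw [Nat.sum_antidiagonal_succ]
    simp only [Nat.cast_zero, zero_mul, mul_zero, zero_add]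
    refine sum_congr rfl fun ij hij => ?_
    rw [HasAntidiagonal.mem_antidiagonal] at hij
    rw [← hij, ← padeCoeff_succ_left]
    push_cast; ring
  have h3 : 4 * (r + 1) * ∑ ij ∈ antidiagonal (r + 1),
        padeCoeff ij.1 ij.2 * ((ij.2 - ij.1 + 1 / 4) * F ij.1 ij.2) =
      ∑ ij ∈ antidiagonal (r + 1), padeCoeff ij.1 ij.2 * (ij.2 * (4 * ij.2 + 1)) * F ij.1 ij.2 -
      ∑ ij ∈ antidiagonal (r + 1), padeCoeff ij.1 ij.2 * (ij.1 * (4 * ij.1 - 1)) * F ij.1 ij.2 := by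
    rw [mul_sum, ← sum_sub_distrib]
    refine sum_congr rfl fun ij hij => ?_
    rw [HasAntidiagonal.mem_antidiagonal] at hij
    have : (r : ℝ) + 1 = ij.1 + ij.2 := by exact_mod_cast hij.symm
    rw [this]; ring
  rw [h3, h1, h2, ← sum_sub_distrib, mul_sum]
  exact sum_congr rfl fun ij _ => by ring

theorem hasDerivAt_padeSin_succ (r : ℕ) (x : ℝ) :
    HasDerivAt (padeSin (r + 1))
      (-((16 * ((r : ℝ) + 1) ^ 2 - 1) / (2 * (r + 1))) * (Real.sin x * padeSin r x)) x := by
  have h : HasDerivAt (padeSin (r + 1)) (∑ ij ∈ antidiagonal (r + 1), padeCoeff ij.1 ij.2 *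
      ((ij.2 - ij.1 + 1 / 4) * Real.cos ((ij.2 - ij.1 + 1 / 4) * x))) x := by
    unfold padeSin
    refine HasDerivAt.fun_sum fun ij _ => ?_
    have := ((hasDerivAt_id x).const_mul ((ij.2 : ℝ) - ij.1 + 1 / 4)).sin.const_mul
      (padeCoeff ij.1 ij.2)
    simp only [id, mul_one] at this
    exact this.congr_deriv (by ring)
  have e := padeCoeff_weighted_sum r fun i j => Real.cos ((j - i + 1 / 4) * x)
  have hs : ∑ ij ∈ antidiagonal r, padeCoeff ij.1 ij.2 *
      (Real.cos (((ij.2 + 1 : ℕ) - ij.1 + 1 / 4) * x) -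
        Real.cos ((ij.2 - (ij.1 + 1 : ℕ) + 1 / 4) * x)) = -2 * (Real.sin x * padeSin r x) := by
    unfold padeSin
    rw [mul_sum, mul_sum]
    refine sum_congr rfl fun ij _ => ?_
    push_cast
    have e1 : ((ij.2 : ℝ) + 1 - ij.1 + 1 / 4) * x = (ij.2 - ij.1 + 1 / 4) * x + x := by ring
    have e2 : ((ij.2 : ℝ) - (ij.1 + 1) + 1 / 4) * x = (ij.2 - ij.1 + 1 / 4) * x - x := by ring
    rw [e1, e2, Real.cos_add, Real.cos_sub]; ring
  rw [hs] at e
  refine h.congr_deriv ?_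
  have : (r : ℝ) + 1 ≠ 0 := by positivity
  rw [← mul_left_cancel_iff_of_pos (show (0 : ℝ) < 4 * (r + 1) by positivity), e]
  field_simp
  ring

theorem padeSin_zero_right (r : ℕ) : padeSin r 0 = 0 := by simp [padeSin]

/-- The leading constant of the Padé remainder. -/
noncomputable def padeConst (r : ℕ) : ℝ :=
  ∏ s ∈ range r, (16 * ((s : ℝ) + 1) ^ 2 - 1) / (2 * (s + 1) * (2 * s + 3))

theorem padeConst_succ (r : ℕ) : padeConst (r + 1) =
    padeConst r * ((16 * ((r : ℝ) + 1) ^ 2 - 1) / (2 * (r + 1) * (2 * r + 3))) :=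
  prod_range_succ _ _

theorem padeConst_pos (r : ℕ) : 0 < padeConst r := by
  refine prod_pos fun s _ => div_pos ?_ (by positivity)
  have : (0 : ℝ) ≤ s := Nat.cast_nonneg s
  nlinarith

theorem padeConst_le (r : ℕ) : padeConst r ≤ 4 ^ r := by
  induction r with
  | zero => simp [padeConst]
  | succ r ih =>
    rw [padeConst_succ, pow_succ]
    have hr : (0 : ℝ) ≤ r := Nat.cast_nonneg r
    refine mul_le_mul ih ?_ (div_nonneg (by nlinarith) (by positivity))
      (by positivity : (0 : ℝ) ≤ 4 ^ r)
    rw [div_le_iff₀ (by positivity)]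
    nlinarith

theorem centralBinom_le_padeConst (r : ℕ) : ((2 * r).choose r : ℝ) ≤ padeConst r := by
  induction r with
  | zero => simp [padeConst]
  | succ r ih =>
    have hr : (0 : ℝ) ≤ r := Nat.cast_nonneg r
    have h := Nat.succ_mul_centralBinom_succ r
    rw [Nat.centralBinom_eq_two_mul_choose, Nat.centralBinom_eq_two_mul_choose] at h
    have h' : ((r : ℝ) + 1) * ((2 * (r + 1)).choose (r + 1) : ℕ) =
        2 * (2 * r + 1) * ((2 * r).choose r : ℕ) := by exact_mod_cast h
    have e : ((2 * (r + 1)).choose (r + 1) : ℝ) =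
        ((2 * r).choose r : ℕ) * (2 * (2 * r + 1) / (r + 1)) := by
      field_simp; linarith
    rw [padeConst_succ, e]
    refine mul_le_mul ih ?_ (by positivity) (padeConst_pos r).le
    rw [div_le_div_iff₀ (by positivity) (by positivity)]
    nlinarith [mul_nonneg hr hr, mul_nonneg (mul_nonneg hr hr) hr]

theorem abs_padeCos_le (r : ℕ) (x : ℝ) : |padeCos r x| ≤ 4 ^ r * padeConst r := by
  calc |padeCos r x| ≤ ∑ ij ∈ antidiagonal r, padeCoeff ij.1 ij.2 := by
        refine (abs_sum_le_sum_abs _ _).trans (sum_le_sum fun ij _ => ?_)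
        rw [abs_mul, abs_of_pos (padeCoeff_pos _ _)]
        exact mul_le_of_le_one_right (padeCoeff_pos _ _).le (Real.abs_cos_le_one _)
    _ = 4 ^ r * (2 * r).choose r := sum_padeCoeff r
    _ ≤ _ := by gcongr; exact centralBinom_le_padeConst r

theorem padeSin_bounds {c x₀ : ℝ} (hc : 0 ≤ c) (hx₀ : x₀ ≤ Real.pi)
    (hsin : ∀ x, 0 ≤ x → x ≤ x₀ → c * x ≤ Real.sin x) (r : ℕ) :
    ∀ x, 0 ≤ x → x ≤ x₀ →
      c ^ (r + 1) * padeConst r * x ^ (2 * r + 1) / 4 ≤ (-1) ^ r * padeSin r x ∧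
      (-1) ^ r * padeSin r x ≤ padeConst r * x ^ (2 * r + 1) / 4 := by
  induction r with
  | zero =>
    intro x h0 h1
    have e : padeSin 0 x = Real.sin (x / 4) := by
      simp [padeSin, padeCoeff_zero]; congr 1; ring
    have := hsin (x / 4) (by positivity) (by linarith)
    have := Real.sin_le (show 0 ≤ x / 4 by positivity)
    simp only [e, padeConst, range_zero, prod_empty]
    constructor <;> norm_num <;> linarith
  | succ r ih =>
    have hr : (0 : ℝ) ≤ r := Nat.cast_nonneg r
    obtain ⟨K, hK⟩ : ∃ K : ℝ, K = (16 * ((r : ℝ) + 1) ^ 2 - 1) / (2 * (r + 1)) := ⟨_, rfl⟩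
    have hK0 : 0 ≤ K := hK ▸ div_nonneg (by nlinarith) (by positivity)
    have hKc : padeConst (r + 1) * (2 * r + 3) = padeConst r * K := by
      rw [padeConst_succ, hK]; field_simp
    have hd : ∀ x, HasDerivAt (fun x => (-1) ^ (r + 1) * padeSin (r + 1) x)
        (K * (Real.sin x * ((-1) ^ r * padeSin r x))) x := by
      intro x
      have h : HasDerivAt (padeSin (r + 1)) (-K * (Real.sin x * padeSin r x)) x :=
        hK ▸ hasDerivAt_padeSin_succ r x
      exact (h.const_mul ((-1 : ℝ) ^ (r + 1))).congr_deriv (by rw [pow_succ]; ring)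
    have hp : ∀ C x : ℝ, HasDerivAt (fun x => C * padeConst (r + 1) * x ^ (2 * (r + 1) + 1) / 4)
        (C * (K * (x * (padeConst r * x ^ (2 * r + 1) / 4)))) x := by
      intro C x
      refine ((((hasDerivAt_id x).pow (2 * (r + 1) + 1)).const_mul
        (C * padeConst (r + 1))).div_const 4).congr_deriv ?_
      rw [mul_one, Nat.add_sub_cancel, show 2 * (r + 1) = 2 * r + 1 + 1 by ring]
      simp only [id, pow_succ]
      push_cast
      linear_combination (C * x ^ (2 * r) * x * x / 4) * hKc
    have main : ∀ f g f' g' : ℝ → ℝ, (∀ x, HasDerivAt f (f' x) x) → (∀ x, HasDerivAt g (g' x) x) →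
        f 0 = g 0 → (∀ x, 0 ≤ x → x ≤ x₀ → f' x ≤ g' x) → ∀ x, 0 ≤ x → x ≤ x₀ → f x ≤ g x := by
      intro f g f' g' hf hg h0 hle x hx hx'
      have hm : MonotoneOn (fun x => g x - f x) (Set.Icc 0 x) := by
        refine monotoneOn_of_deriv_nonneg (convex_Icc _ _)
          (fun y _ => ((hg y).sub (hf y)).continuousAt.continuousWithinAt)
          (fun y _ => ((hg y).sub (hf y)).differentiableAt.differentiableWithinAt) fun y hy => ?_
        rw [interior_Icc] at hy
        have : deriv (fun x => g x - f x) y = g' y - f' y := ((hg y).sub (hf y)).deriv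
        rw [this, sub_nonneg]
        exact hle y hy.1.le (hy.2.le.trans hx')
      have := hm (Set.left_mem_Icc.mpr hx) (Set.right_mem_Icc.mpr hx) hx
      simp only [h0, sub_self] at this
      linarith
    intro x hx hx'
    constructor
    · refine main _ _ _ _ (hp (c ^ (r + 1 + 1))) hd ?_ ?_ x hx hx'
      · simp [padeSin_zero_right]
      · intro y hy hy'
        have h1 := (ih y hy hy').1
        have h2 := hsin y hy hy'
        have h3 : 0 ≤ c ^ (r + 1) * padeConst r * y ^ (2 * r + 1) / 4 := by
          have := (padeConst_pos r).le
          positivity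
        calc _ = K * ((c * y) * (c ^ (r + 1) * padeConst r * y ^ (2 * r + 1) / 4)) := by
              rw [pow_succ c (r + 1)]; ring
          _ ≤ _ := by
              refine mul_le_mul_of_nonneg_left (mul_le_mul h2 h1 h3 ?_) hK0
              exact Real.sin_nonneg_of_nonneg_of_le_pi hy (hy'.trans hx₀)
    · have := main _ _ _ _ hd (hp 1) (by simp [padeSin_zero_right]) ?_ x hx hx'
      · simpa using this
      · intro y hy hy'
        have h1 := (ih y hy hy').2
        have h2 := Real.sin_le hy
        have h0 : 0 ≤ (-1) ^ r * padeSin r y := le_trans (by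
          have := (padeConst_pos r).le
          positivity) (ih y hy hy').1
        rw [one_mul]
        exact mul_le_mul_of_nonneg_left (mul_le_mul h2 h1 h0 hy) hK0

open Complex in
theorem exp_mul_padePoly (r : ℕ) (n x : ℝ) :
    exp ((x / 4 : ℝ) * I) * padePoly r (n * exp (x * I)) (n * exp (-(x * I))) =
      n ^ r * (padeCos r x + padeSin r x * I) := by
  unfold padePoly padeCos padeSin
  rw [ofReal_sum, ofReal_sum, sum_mul, ← sum_add_distrib, mul_sum, mul_sum]
  refine sum_congr rfl fun ij hij => ?_
  rw [HasAntidiagonal.mem_antidiagonal] at hij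
  have e : exp ((((ij.2 : ℝ) - ij.1 + 1 / 4) * x : ℝ) * I) =
      exp ((x / 4 : ℝ) * I) * exp (x * I) ^ ij.2 * exp (-(x * I)) ^ ij.1 := by
    rw [← exp_nat_mul, ← exp_nat_mul, ← exp_add, ← exp_add]
    congr 1; push_cast; ring
  have e2 := exp_mul_I ((((ij.2 : ℝ) - ij.1 + 1 / 4) * x : ℝ) : ℂ)
  rw [e, ← ofReal_cos, ← ofReal_sin] at e2
  rw [← hij, pow_add, ofReal_mul, ofReal_mul, mul_pow, mul_pow]
  linear_combination (padeCoeff ij.1 ij.2 * n ^ ij.1 * n ^ ij.2 : ℂ) * e2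

theorem mul_le_sin_of_small {x : ℝ} (h0 : 0 ≤ x) (h1 : x ≤ 7 / 100) :
    999 / 1000 * x ≤ Real.sin x := by
  rcases h0.eq_or_lt with rfl | h
  · simp
  · have := Real.sin_gt_sub_cube h
    nlinarith [mul_nonneg h0 (mul_nonneg h0 (sub_nonneg.2 h1)), mul_nonneg h0 (sub_nonneg.2 h1)]

theorem small_of_sin_le {x : ℝ} (h0 : 0 ≤ x) (h1 : x ≤ Real.pi / 2) (h : Real.sin x ≤ 1 / 33) :
    x ≤ 7 / 100 := by
  have h2 := Real.mul_le_sin h0 h1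
  have h3 := Real.pi_lt_d2
  have h4 := Real.pi_pos
  have h5 : 2 / Real.pi * x ≤ 1 / 33 := h2.trans h
  rw [div_mul_eq_mul_div, div_le_iff₀ h4] at h5
  linarith

theorem pade_gap_lower_bound {n φ φ₂ R S b D : ℝ} (hb : 1 ≤ b) (hbD : b ≤ D)
    (hφ0 : 0 < φ) (hφs : φ ≤ 7 / 100) (hn : 33 * b ≤ n) (hδφ : |φ₂| < φ)
    (hδS : 999 / 1000 * (|φ₂| * (D * S ^ 4)) ≤ 4 * (b * n))
    (hn2φ3 : n ^ 2 * φ ^ 3 * 32 ≤ b) (hR : 0 < R) (hRS : R ≤ S)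
    (hG : ∃ G : ℤ, R * n ^ 0 *
      (padeSin 0 φ * Real.cos (φ₂ / 4) - padeCos 0 φ * Real.sin (φ₂ / 4)) = G) :
    39 / 10 ≤ S * φ := by
  have hS0 : 0 < S := hR.trans_le hRS
  have hD0 : 0 < D := by linarith
  have hn0 : 0 < n := by linarith
  set δ := |φ₂| with hδ
  have hδ0 : 0 ≤ δ := abs_nonneg _
  obtain ⟨G, hG0⟩ := hG
  have e1 : padeSin 0 φ = Real.sin (φ / 4) := by
    simp [padeSin, padeCoeff_zero]; congr 1; ring
  have e2 : padeCos 0 φ = Real.cos (φ / 4) := by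
    simp [padeCos, padeCoeff_zero]; congr 1; ring
  rw [e1, e2, ← Real.sin_sub, pow_zero, mul_one] at hG0
  have h1 : 0 < φ / 4 - φ₂ / 4 := by linarith [le_abs_self φ₂]
  have h2 : φ / 4 - φ₂ / 4 ≤ (φ + δ) / 4 := by linarith [neg_abs_le φ₂]
  have h3 : 0 < Real.sin (φ / 4 - φ₂ / 4) :=
    Real.sin_pos_of_pos_of_lt_pi h1 (by linarith [Real.pi_gt_three])
  have h4 : (1 : ℝ) ≤ G := by
    have : (0 : ℝ) < G := hG0 ▸ mul_pos hR h3
    exact_mod_cast this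
  have h5 : 1 ≤ S * ((φ + δ) / 4) := by
    calc (1 : ℝ) ≤ R * Real.sin (φ / 4 - φ₂ / 4) := by rw [hG0]; exact h4
      _ ≤ S * ((φ + δ) / 4) :=
        mul_le_mul hRS ((Real.sin_le h1.le).trans h2) h3.le hS0.le
  have h6 : 2 ≤ S * φ := by linarith [mul_lt_mul_of_pos_left hδφ hS0]
  have h7 : 16 ≤ (S * φ) ^ 4 := by
    have := pow_le_pow_left₀ (by norm_num) h6 4
    linarith
  have h8 : δ * 100 ≤ φ := by
    have h9 : 999 / 1000 * (δ * D * (S * φ) ^ 4) ≤ 4 * b * (n * φ ^ 4) := by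
      have := mul_le_mul_of_nonneg_right hδS (show 0 ≤ φ ^ 4 by positivity)
      linarith
    have h10 : δ * D * 16 ≤ δ * D * (S * φ) ^ 4 := by gcongr
    have h12 : n * (n * φ ^ 4 * 32) ≤ b * φ := by
      have := mul_le_mul_of_nonneg_right hn2φ3 hφ0.le
      linarith
    have h13 : 33 * b * (n * φ ^ 4 * 32) ≤ n * (n * φ ^ 4 * 32) := by gcongr
    have h14 : b * φ ≤ D * φ := by gcongr
    have h15 : 0 ≤ D * φ := by positivity
    have : D * (δ * 100) ≤ D * φ := by linarith
    exact le_of_mul_le_mul_left this hD0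
  linarith [mul_le_mul_of_nonneg_left h8 hS0.le]

theorem pade_gap_zero {n φ φ₂ R S b D q : ℝ} {s : ℕ} {G : ℤ} (hb : 1 ≤ b)
    (hbD : b ^ 2 ≤ D) (hn0 : 0 < n) (hφ0 : 0 < φ) (hφs : φ ≤ 7 / 100)
    (hnφ : 999 / 1000 * (n * φ) ≤ b) (hδφ : |φ₂| < φ)
    (hδS : 999 / 1000 * (|φ₂| * (D * S ^ 4)) ≤ 4 * (b * n))
    (hn2φ6 : 1024 * (n ^ 4 * φ ^ 6) ≤ 999 / 1000)
    (hR : 0 < R) (hRS : R ≤ S)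
    (hq : q = 4 * n * φ ^ 2) (hq0 : 0 < q)
    (hs2 : 3 ≤ S * φ * q ^ s) (hGs : R * n ^ (s + 1) * (padeSin (s + 1) φ * Real.cos (φ₂ / 4) -
      padeCos (s + 1) φ * Real.sin (φ₂ / 4)) = G)
    (hG0 : G = 0) : False := by
  have hS0 : 0 < S := hR.trans_le hRS
  have hD0 : 0 < D := by nlinarith
  have hbD1 : b ≤ D := by nlinarith
  set δ := |φ₂| with hδ
  have hδ0 : 0 ≤ δ := abs_nonneg _
  obtain ⟨hfl, hfu⟩ := padeSin_bounds (c := 999 / 1000) (by norm_num)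
    (show (7 / 100 : ℝ) ≤ Real.pi by linarith [Real.pi_gt_three])
    (fun x h0 h1 => mul_le_sin_of_small h0 h1) (s + 1) φ hφ0.le hφs
  have hκ := padeConst_pos (s + 1)
  have hκle := padeConst_le (s + 1)
  have hfabs : (-1) ^ (s + 1) * padeSin (s + 1) φ = |padeSin (s + 1) φ| := by
    have h0 : 0 ≤ (-1) ^ (s + 1) * padeSin (s + 1) φ := le_trans (by positivity) hfl
    rw [← abs_of_nonneg h0, abs_mul, abs_pow]; simp
  rw [hfabs] at hfl hfu
  have hg := abs_padeCos_le (s + 1) φ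
  have hsinδ : |Real.sin (φ₂ / 4)| ≤ δ / 4 := by
    refine Real.abs_sin_le_abs.trans ?_
    rw [abs_div, hδ]; norm_num
  have hcosδ : 99 / 100 ≤ Real.cos (φ₂ / 4) := by
    have := Real.one_sub_sq_div_two_le_cos (x := φ₂ / 4)
    have h2 : φ₂ ^ 2 ≤ (7 / 100) ^ 2 := by
      rw [← sq_abs]; exact pow_le_pow_left₀ hδ0 (by linarith) 2
    nlinarith
  have hL : 0 < φ * q ^ s := by positivity
  have hSL : 3 ≤ S * (φ * q ^ s) := by linarith
  have h1 : padeSin (s + 1) φ * Real.cos (φ₂ / 4) = padeCos (s + 1) φ * Real.sin (φ₂ / 4) := by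
    rw [hG0, Int.cast_zero] at hGs
    have := (mul_eq_zero.1 hGs).resolve_left (by positivity)
    linarith
  have h2 : |padeSin (s + 1) φ| * Real.cos (φ₂ / 4) ≤ 4 ^ (s + 1) * padeConst (s + 1) * (δ / 4) := by
    rw [← abs_of_pos (show 0 < Real.cos (φ₂ / 4) by linarith), ← abs_mul, h1, abs_mul]
    exact mul_le_mul hg hsinδ (abs_nonneg _) (by positivity)
  have h3 : (999 / 1000) ^ (s + 1 + 1) * padeConst (s + 1) * φ ^ (2 * (s + 1) + 1) / 4 * (99 / 100)
      ≤ 4 ^ (s + 1) * padeConst (s + 1) * (δ / 4) :=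
    (mul_le_mul hfl hcosδ (by norm_num) (abs_nonneg _)).trans h2
  have h4 : 99 / 100 * (999 / 1000) ^ (s + 2) * φ ^ (2 * s + 3) ≤ 4 ^ (s + 1) * δ := by
    refine le_of_mul_le_mul_left ?_ (show 0 < padeConst (s + 1) / 4 by positivity)
    calc _ = _ := by ring
      _ ≤ _ := h3
      _ = _ := by ring
  have h5 : 99 / 100 * (999 / 1000) ^ (s + 3) * φ ^ (2 * s + 3) * D * S ^ 4 ≤
      4 ^ (s + 1) * (4 * (b * n)) := by
    calc _ = 99 / 100 * (999 / 1000) ^ (s + 2) * φ ^ (2 * s + 3) * (999 / 1000 * D * S ^ 4) := by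
          ring
      _ ≤ 4 ^ (s + 1) * δ * (999 / 1000 * D * S ^ 4) := by gcongr
      _ = 4 ^ (s + 1) * (999 / 1000 * (δ * (D * S ^ 4))) := by ring
      _ ≤ _ := by gcongr
  have h6 : 81 ≤ (S * (φ * q ^ s)) ^ 4 := by
    have := pow_le_pow_left₀ (by norm_num) hSL 4
    linarith
  have h7 : (4 * q ^ 4) ^ s ≤ (999 / 1000 * φ ^ 2) ^ s := by
    refine pow_le_pow_left₀ (by positivity) ?_ s
    have : 4 * q ^ 4 = 1024 * (n ^ 4 * φ ^ 6) * φ ^ 2 := by rw [hq]; ring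
    rw [this]; gcongr
  have h8 : 99 / 100 * (999 / 1000) ^ (s + 3) * φ ^ (2 * s + 3) * D * 81 ≤
      16 * (b * n) * φ ^ 4 * (999 / 1000 * φ ^ 2) ^ s := by
    calc _ ≤ 99 / 100 * (999 / 1000) ^ (s + 3) * φ ^ (2 * s + 3) * D * (S * (φ * q ^ s)) ^ 4 := by
          gcongr
      _ = 99 / 100 * (999 / 1000) ^ (s + 3) * φ ^ (2 * s + 3) * D * S ^ 4 * (φ * q ^ s) ^ 4 := by
          ring
      _ ≤ 4 ^ (s + 1) * (4 * (b * n)) * (φ * q ^ s) ^ 4 := by gcongr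
      _ = 16 * (b * n) * φ ^ 4 * (4 * q ^ 4) ^ s := by
          rw [mul_pow 4, ← pow_mul, mul_pow φ, ← pow_mul, mul_comm s 4]; ring
      _ ≤ _ := by gcongr
  have h9 : 99 / 100 * (999 / 1000) ^ 3 * 81 * D ≤ 16 * b * (n * φ) := by
    refine le_of_mul_le_mul_left ?_ (show 0 < (999 / 1000 : ℝ) ^ s * φ ^ (2 * s) * φ ^ 3 by
      positivity)
    calc _ = _ := by ring
      _ ≤ _ := h8
      _ = _ := by rw [mul_pow (999 / 1000 : ℝ), ← pow_mul]; ring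
  have h10 := mul_le_mul_of_nonneg_left hnφ (show 0 ≤ b by linarith)
  linarith

theorem pade_gap_ne_zero {n φ φ₂ R S b D q : ℝ} {s : ℕ} {G : ℤ} (hb : 1 ≤ b)
    (hbD : b ^ 2 ≤ D) (hn0 : 0 < n) (hφ0 : 0 < φ) (hφs : φ ≤ 7 / 100)
    (hδS : 999 / 1000 * (|φ₂| * (D * S ^ 4)) ≤ 4 * (b * n))
    (hn2φ6 : 1024 * (n ^ 4 * φ ^ 6) ≤ 999 / 1000)
    (hn2φ3 : n ^ 2 * φ ^ 3 * 32 ≤ b) (hR : 0 < R) (hRS : R ≤ S)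
    (hq : q = 4 * n * φ ^ 2) (hq0 : 0 < q) (hs1 : S * φ * q ^ (s + 1) < 3)
    (hs2 : 3 ≤ S * φ * q ^ s) (hGs : R * n ^ (s + 1) * (padeSin (s + 1) φ * Real.cos (φ₂ / 4) -
      padeCos (s + 1) φ * Real.sin (φ₂ / 4)) = G)
    (hG0 : G ≠ 0) : False := by
  have hS0 : 0 < S := hR.trans_le hRS
  have hD0 : 0 < D := by nlinarith
  have hbD1 : b ≤ D := by nlinarith
  set δ := |φ₂| with hδ
  have hδ0 : 0 ≤ δ := abs_nonneg _
  obtain ⟨hfl, hfu⟩ := padeSin_bounds (c := 999 / 1000) (by norm_num)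
    (show (7 / 100 : ℝ) ≤ Real.pi by linarith [Real.pi_gt_three])
    (fun x h0 h1 => mul_le_sin_of_small h0 h1) (s + 1) φ hφ0.le hφs
  have hκ := padeConst_pos (s + 1)
  have hκle := padeConst_le (s + 1)
  have hfabs : (-1) ^ (s + 1) * padeSin (s + 1) φ = |padeSin (s + 1) φ| := by
    have h0 : 0 ≤ (-1) ^ (s + 1) * padeSin (s + 1) φ := le_trans (by positivity) hfl
    rw [← abs_of_nonneg h0, abs_mul, abs_pow]; simp
  rw [hfabs] at hfl hfu
  have hg := abs_padeCos_le (s + 1) φ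
  have hsinδ : |Real.sin (φ₂ / 4)| ≤ δ / 4 := by
    refine Real.abs_sin_le_abs.trans ?_
    rw [abs_div, hδ]; norm_num
  have hL : 0 < φ * q ^ s := by positivity
  have hSL : 3 ≤ S * (φ * q ^ s) := by linarith
  have h1 : (1 : ℝ) ≤ |(G : ℝ)| := by exact_mod_cast Int.one_le_abs hG0
  have h2 : |(G : ℝ)| ≤ S * n ^ (s + 1) * (|padeSin (s + 1) φ| + |padeCos (s + 1) φ| * (δ / 4)) := by
    rw [← hGs, abs_mul, abs_of_pos (show 0 < R * n ^ (s + 1) by positivity)]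
    gcongr
    refine (abs_sub _ _).trans (add_le_add ?_ ?_)
    · rw [abs_mul]
      exact mul_le_of_le_one_right (abs_nonneg _) (Real.abs_cos_le_one _)
    · rw [abs_mul]; gcongr
  have h3 : S * n ^ (s + 1) * |padeSin (s + 1) φ| ≤ S * φ * q ^ (s + 1) / 4 := by
    calc _ ≤ S * n ^ (s + 1) * (4 ^ (s + 1) * φ ^ (2 * (s + 1) + 1) / 4) := by
          gcongr
          exact hfu.trans (by gcongr)
      _ = _ := by rw [hq, mul_pow, mul_pow, ← pow_mul]; ring
  have h4 : S * n ^ (s + 1) * (|padeCos (s + 1) φ| * (δ / 4)) ≤ S * (16 * n) ^ (s + 1) * δ / 4 := by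
    calc _ ≤ S * n ^ (s + 1) * (4 ^ (s + 1) * 4 ^ (s + 1) * (δ / 4)) := by
          gcongr
          exact hg.trans (by gcongr)
      _ = _ := by
            have : (16 : ℝ) ^ (s + 1) = 4 ^ (s + 1) * 4 ^ (s + 1) := by rw [← mul_pow]; norm_num
            rw [mul_pow, this]; ring
  have h5 : 1 < S * (16 * n) ^ (s + 1) * δ := by linarith
  have h6 : 999 / 1000 * D * S ^ 3 ≤ 64 * b * n ^ 2 * (16 * n) ^ s := by
    calc 999 / 1000 * D * S ^ 3 ≤ 999 / 1000 * D * S ^ 3 * (S * (16 * n) ^ (s + 1) * δ) :=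
          le_mul_of_one_le_right (by positivity) h5.le
      _ = (999 / 1000 * (δ * (D * S ^ 4))) * (16 * n) ^ (s + 1) := by ring
      _ ≤ 4 * (b * n) * (16 * n) ^ (s + 1) := by gcongr
      _ = _ := by ring
  have h7 : 27 ≤ (S * (φ * q ^ s)) ^ 3 := by
    have := pow_le_pow_left₀ (by norm_num) hSL 3
    linarith
  have h8 : 999 / 1000 * D * 27 ≤ 64 * b * (n ^ 2 * φ ^ 3) := by
    calc _ ≤ 999 / 1000 * D * (S * (φ * q ^ s)) ^ 3 := by gcongr
      _ = 999 / 1000 * D * S ^ 3 * (φ * q ^ s) ^ 3 := by ring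
      _ ≤ 64 * b * n ^ 2 * (16 * n) ^ s * (φ * q ^ s) ^ 3 := by gcongr
      _ = 64 * b * (n ^ 2 * φ ^ 3) * (16 * n * q ^ 3) ^ s := by
          rw [mul_pow φ, ← pow_mul, mul_comm s 3, pow_mul, mul_pow (16 * n)]; ring
      _ ≤ 64 * b * (n ^ 2 * φ ^ 3) * 1 := by
          gcongr
          refine pow_le_one₀ (by positivity) ?_
          have : 16 * n * q ^ 3 = 1024 * (n ^ 4 * φ ^ 6) := by rw [hq]; ring
          rw [this]; linarith
      _ = _ := mul_one _
  have h9 := mul_le_mul_of_nonneg_left hn2φ3 (show 0 ≤ b by linarith)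
  linarith

theorem pade_gap_contradiction {n n₂ φ φ₂ R S b D : ℝ} (hb : 1 ≤ b) (hD : b ^ 2 ≤ D)
    (hn0 : 0 < n) (hn : 1100 * b ^ 6 ≤ n ^ 2) (hφ0 : 0 < φ) (hφ1 : φ ≤ Real.pi / 2)
    (hφ : n * Real.sin φ = b) (hφ₂1 : |φ₂| ≤ Real.pi / 2) (hφ₂ : n₂ * |Real.sin φ₂| = b)
    (hnn : n < n₂) (hS : 4 * (n * n₂) = D * S ^ 4) (hR : 0 < R) (hRS : R ≤ S)
    (hG : ∀ r, ∃ G : ℤ, R * n ^ r *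
      (padeSin r φ * Real.cos (φ₂ / 4) - padeCos r φ * Real.sin (φ₂ / 4)) = G) : False := by
  have hS0 : 0 < S := hR.trans_le hRS
  have hD0 : 0 < D := by nlinarith
  have hbD : b ≤ D := by nlinarith
  have hn33 : 33 * b ^ 3 ≤ n := by
    refine (sq_le_sq₀ (by positivity) hn0.le).1 (le_trans ?_ hn)
    have : (33 * b ^ 3) ^ 2 = 1089 * b ^ 6 := by ring
    rw [this]; gcongr; norm_num
  have hb3 : b ≤ b ^ 3 := le_self_pow₀ hb (by norm_num)
  have hn33' : 33 * b ≤ n := by linarith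
  have hn20 : 0 < n₂ := hn0.trans hnn
  set δ := |φ₂| with hδ
  have hδ0 : 0 ≤ δ := abs_nonneg _
  have hδs : n₂ * Real.sin δ = b := by
    rw [← hφ₂, ← Real.abs_sin_eq_sin_abs_of_abs_le_pi (by linarith [Real.pi_pos])]
  have hφs : φ ≤ 7 / 100 := by
    refine small_of_sin_le hφ0.le hφ1 ?_
    nlinarith
  have hlow := mul_le_sin_of_small hφ0.le hφs
  have hup := Real.sin_le hφ0.le
  have hnφ1 : 999 / 1000 * (n * φ) ≤ b := by
    linarith [mul_le_mul_of_nonneg_left hlow hn0.le]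
  have hnφ2 : b ≤ n * φ := by linarith [mul_le_mul_of_nonneg_left hup hn0.le]
  have hδφ : δ < φ := by
    by_contra! h
    have := Real.sin_le_sin_of_le_of_le_pi_div_two (by linarith) hφ₂1 h
    nlinarith
  have hδlow := mul_le_sin_of_small hδ0 (hδφ.le.trans hφs)
  have hδS : 999 / 1000 * (δ * (D * S ^ 4)) ≤ 4 * (b * n) := by
    rw [← hS]
    have : 999 / 1000 * (n₂ * δ) ≤ b := by linarith [mul_le_mul_of_nonneg_left hδlow hn20.le]
    linarith [mul_le_mul_of_nonneg_left this hn0.le]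
  have hn2φ6 : 1024 * (n ^ 4 * φ ^ 6) ≤ 999 / 1000 := by
    have h1 : (999 / 1000 * (n * φ)) ^ 6 ≤ b ^ 6 := by
      apply pow_le_pow_left₀ (by positivity) hnφ1
    have h2 : n ^ 2 * (n ^ 4 * φ ^ 6) = (n * φ) ^ 6 := by ring
    rw [mul_pow, ← h2] at h1
    have h3 : 1100 * b ^ 6 * (n ^ 4 * φ ^ 6) ≤ n ^ 2 * (n ^ 4 * φ ^ 6) := by gcongr
    have hb6 : 0 < b ^ 6 := by positivity
    by_contra! h
    linarith [mul_lt_mul_of_pos_left h hb6]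
  have hn2φ3 : n ^ 2 * φ ^ 3 * 32 ≤ b := by
    have h1 : (999 / 1000 * (n * φ)) ^ 3 ≤ b ^ 3 := by
      apply pow_le_pow_left₀ (by positivity) hnφ1
    have h2 : n * (n ^ 2 * φ ^ 3) = (n * φ) ^ 3 := by ring
    rw [mul_pow, ← h2] at h1
    have h4 : 0 < n ^ 2 * φ ^ 3 := by positivity
    have h3 : 33 * b ^ 3 * (n ^ 2 * φ ^ 3) ≤ n * (n ^ 2 * φ ^ 3) := by gcongr
    have hb3 : 0 < b ^ 3 := by positivity
    by_contra! h
    linarith [mul_lt_mul_of_pos_left (hb.trans_lt h) hb3]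
  have hSφ : 39 / 10 ≤ S * φ :=
    pade_gap_lower_bound hb hbD hφ0 hφs hn33' hδφ hδS hn2φ3 hR hRS (hG 0)
  obtain ⟨q, hq⟩ : ∃ q, q = 4 * n * φ ^ 2 := ⟨_, rfl⟩
  have hq0 : 0 < q := by rw [hq]; positivity
  have hq1 : q < 1 := by
    have : n * φ ^ 2 * 900 ≤ n * n * φ ^ 2 * (900 / 33) := by
      have : 33 ≤ n := by linarith
      nlinarith [show 0 < n * φ ^ 2 by positivity]
    have h4 : 1024 * (n * φ ^ 2) ^ 3 ≤ 999 / 1000 := by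
      refine le_trans ?_ hn2φ6
      have : (n * φ ^ 2) ^ 3 = n ^ 3 * φ ^ 6 := by ring
      rw [this]
      have : n ^ 3 ≤ n ^ 4 := pow_le_pow_right₀ (by linarith) (by norm_num)
      gcongr
    by_contra! h
    have h5 : 1 / 4 ≤ n * φ ^ 2 := by linarith
    have := pow_le_pow_left₀ (by norm_num) h5 3
    linarith
  have hex : ∃ r, S * φ * q ^ r < 3 := by
    obtain ⟨r, hr⟩ := exists_pow_lt_of_lt_one (show 0 < 3 / (S * φ) by positivity) hq1
    exact ⟨r, by rwa [lt_div_iff₀' (by positivity)] at hr⟩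
  obtain ⟨s, hs1, hs2⟩ : ∃ s, S * φ * q ^ (s + 1) < 3 ∧ 3 ≤ S * φ * q ^ s := by
    classical
    have h1 := Nat.find_spec hex
    obtain ⟨s, hs⟩ : ∃ s, Nat.find hex = s + 1 := by
      refine Nat.exists_eq_succ_of_ne_zero fun h0 => ?_
      rw [h0, pow_zero] at h1
      linarith
    refine ⟨s, hs ▸ h1, not_lt.1 (Nat.find_min hex (by omega))⟩
  obtain ⟨G, hGs⟩ := hG (s + 1)
  by_cases hG0 : G = 0
  · exact pade_gap_zero hb hD hn0 hφ0 hφs hnφ1 hδφ hδS hn2φ6 hR hRS hq hq0 hs2 hGs hG0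
  · exact pade_gap_ne_zero hb hD hn0 hφ0 hφs hδS hn2φ6 hn2φ3 hR hRS hq hq0 hs1 hs2 hGs
      hG0

end Pade

theorem exists_gaussianInt_mul_real {u : ℂ} (h0 : u ≠ 0) (h : (u ^ 4).im = 0) :
    ∃ (g : GaussianInt) (R : ℝ), g.norm ≤ 2 ∧ 0 < R ∧ u * g.toComplex = R := by
  obtain ⟨x, y⟩ := u
  have e : 4 * x * y * (x - y) * (x + y) = 0 := by
    rw [← h]; simp [pow_succ]; ring
  have main : ∃ (g : GaussianInt) (R : ℝ), g.norm ≤ 2 ∧ R ≠ 0 ∧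
      (⟨x, y⟩ : ℂ) * g.toComplex = R := by
    rcases mul_eq_zero.1 e with e | e
    · rcases mul_eq_zero.1 e with e | e
      · rcases mul_eq_zero.1 e with e | e
        · have hx : x = 0 := by linarith
          subst hx
          refine ⟨⟨0, -1⟩, y, by simp [Zsqrtd.norm_def], fun hy => h0 (by simp [hy]; rfl), ?_⟩
          simp [GaussianInt.toComplex_def, Complex.ext_iff]
        · subst e
          refine ⟨1, x, by simp [Zsqrtd.norm_def], fun hy => h0 (by simp [hy]; rfl), ?_⟩
          simp [GaussianInt.toComplex_def, Complex.ext_iff]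
      · have hx : x = y := by linarith
        subst hx
        refine ⟨⟨1, -1⟩, 2 * x, by simp [Zsqrtd.norm_def], fun hy => h0 ?_, ?_⟩
        · have : x = 0 := by linarith
          simp [this]; rfl
        · simp [GaussianInt.toComplex_def, Complex.ext_iff]; ring
    · have hx : y = -x := by linarith
      subst hx
      refine ⟨⟨1, 1⟩, 2 * x, by simp [Zsqrtd.norm_def], fun hy => h0 ?_, ?_⟩
      · have : x = 0 := by linarith
        simp [this]; rfl
      · simp [GaussianInt.toComplex_def, Complex.ext_iff]; ring
  obtain ⟨g, R, hg, hR, hgR⟩ := main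
  rcases hR.lt_or_gt with hR | hR
  · exact ⟨-g, -R, by rwa [Zsqrtd.norm_neg], by linarith, by simp [hgR]⟩
  · exact ⟨g, R, hg, hR, hgR⟩

theorem sq_norm_toComplex (z : GaussianInt) : ‖z.toComplex‖ ^ 2 = z.norm := by
  rw [GaussianInt.intCast_real_norm, Complex.sq_norm]

open Complex in
theorem gaussian_gap {b D Y₁ Y₂ σ : ℤ} {ξ₁ ξ₂ w₁ w₂ : GaussianInt} (hb : 1 ≤ b) (hD : b ^ 2 ≤ D)
    (hξ₁ : 0 < ξ₁.re) (hξ₂ : 0 < ξ₂.re) (hb₁ : ξ₁.im = b) (hb₂ : |ξ₂.im| = b)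
    (hw₁ : w₁.norm = Y₁) (hw₂ : w₂.norm = Y₂) (hn₁ : ξ₁.norm = D * Y₁ ^ 4)
    (hn₂ : ξ₂.norm = D * Y₂ ^ 4) (hσ : ξ₂ * w₁ ^ 4 = σ * (ξ₁ * w₂ ^ 4))
    (hY₁ : 1 ≤ Y₁) (hY : Y₁ < Y₂) (hlarge : 1100 * b ^ 6 ≤ D * Y₁ ^ 4) : False := by
  have hD0 : 0 < D := by nlinarith
  have hre : ∀ z : GaussianInt, z.toComplex.re = z.re := fun z => by rw [GaussianInt.toComplex_def₂]
  have him : ∀ z : GaussianInt, z.toComplex.im = z.im := fun z => by rw [GaussianInt.toComplex_def₂]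
  set x₁ := ξ₁.toComplex with hx₁
  set x₂ := ξ₂.toComplex with hx₂
  have hsq₁ : ‖x₁‖ ^ 2 = D * (Y₁ : ℝ) ^ 4 := by
    rw [hx₁, sq_norm_toComplex, hn₁]; push_cast; ring
  have hsq₂ : ‖x₂‖ ^ 2 = D * (Y₂ : ℝ) ^ 4 := by
    rw [hx₂, sq_norm_toComplex, hn₂]; push_cast; ring
  have hD' : (0 : ℝ) < D := by exact_mod_cast hD0
  have hY₁' : (1 : ℝ) ≤ Y₁ := by exact_mod_cast hY₁
  have hY' : (Y₁ : ℝ) < Y₂ := by exact_mod_cast hY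
  have hY₁0 : (0 : ℝ) < Y₁ := by linarith
  have hY₂0 : (0 : ℝ) < Y₂ := by linarith
  have hn0 : 0 < ‖x₁‖ := by
    rw [norm_pos_iff]; intro h; rw [h] at hsq₁
    have : 0 < D * (Y₁ : ℝ) ^ 4 := by positivity
    rw [← hsq₁] at this
    simp at this
  have hlt : ‖x₁‖ < ‖x₂‖ := by
    refine lt_of_pow_lt_pow_left₀ 2 (norm_nonneg _) ?_
    rw [hsq₁, hsq₂]
    gcongr
  have hn20 : 0 < ‖x₂‖ := hn0.trans hlt
  have he₁ := Complex.norm_mul_exp_arg_mul_I x₁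
  have he₂ := Complex.norm_mul_exp_arg_mul_I x₂
  set φ := arg x₁ with hφ
  set φ₂ := arg x₂ with hφ₂
  set n := ‖x₁‖ with hn
  set n₂ := ‖x₂‖ with hn2
  have hc₁ : (starRingEnd ℂ) x₁ = n * exp (-(φ * I)) := by
    rw [← he₁]
    simp [← exp_conj]
  have hstar : ∀ z : GaussianInt, (star z).toComplex = (starRingEnd ℂ) z.toComplex :=
    fun z => GaussianInt.toComplex_star z
  set v := w₁.toComplex * (starRingEnd ℂ) w₂.toComplex with hv
  have hww : w₂.toComplex * (starRingEnd ℂ) w₂.toComplex = Y₂ := by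
    rw [mul_conj, ← GaussianInt.intCast_real_norm, hw₂]; simp
  have hvn : ‖v‖ ^ 2 = Y₁ * Y₂ := by
    rw [hv, norm_mul, mul_pow, norm_conj, sq_norm_toComplex, sq_norm_toComplex, hw₁, hw₂]
  set u := v * exp (-((φ - φ₂) / 4 * I)) with hu
  have hu4 : n₂ * u ^ 4 = σ * n * (Y₂ : ℂ) ^ 4 := by
    have h1 : x₂ * w₁.toComplex ^ 4 = σ * (x₁ * w₂.toComplex ^ 4) := by
      have := congrArg GaussianInt.toComplex hσ
      simpa using this
    have h2 : x₂ * v ^ 4 = σ * x₁ * (Y₂ : ℂ) ^ 4 := by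
      rw [← hww, hv]
      linear_combination ((starRingEnd ℂ) w₂.toComplex) ^ 4 * h1
    have h3 : exp (-((φ - φ₂) / 4 * I)) ^ 4 * exp (φ * I) = exp (φ₂ * I) := by
      rw [← exp_nat_mul, ← exp_add]; congr 1; push_cast; ring
    rw [← he₁, ← he₂, ← h3] at h2
    have h4 : exp (φ * I) ≠ 0 := exp_ne_zero _
    apply mul_right_cancel₀ h4
    rw [hu]
    linear_combination h2
  have hu0 : u ≠ 0 := by
    refine mul_ne_zero ?_ (exp_ne_zero _)
    intro h
    rw [h] at hvn
    have : 0 < (Y₁ : ℝ) * Y₂ := by positivity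
    simp at hvn
    rcases hvn with h | h <;> linarith
  have hu4im : (u ^ 4).im = 0 := by
    have h1 : u ^ 4 = ((σ * n * (Y₂ : ℝ) ^ 4 / n₂ : ℝ) : ℂ) := by
      have : (n₂ : ℂ) ≠ 0 := by exact_mod_cast hn20.ne'
      push_cast
      field_simp
      linear_combination hu4
    rw [h1, ofReal_im]
  obtain ⟨g, R, hg2, hR, hgR⟩ := exists_gaussianInt_mul_real hu0 hu4im
  have hun : ‖u‖ = ‖v‖ := by
    rw [hu, norm_mul]
    have : -(((φ : ℂ) - φ₂) / 4 * I) = ((-((φ - φ₂) / 4) : ℝ) : ℂ) * I := by push_cast; ring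
    rw [this, norm_exp_ofReal_mul_I, mul_one]
  have hR2 : R ^ 2 ≤ 2 * (Y₁ * Y₂) := by
    have h1 : ‖u * g.toComplex‖ = R := by rw [hgR, norm_real, Real.norm_of_nonneg hR.le]
    rw [← h1, norm_mul, mul_pow, hun, hvn, sq_norm_toComplex]
    have : (g.norm : ℝ) ≤ 2 := by exact_mod_cast hg2
    nlinarith [mul_pos hY₁0 hY₂0]
  have hS2 : Real.sqrt (2 * (Y₁ * Y₂)) ^ 2 = 2 * (Y₁ * Y₂) := Real.sq_sqrt (by positivity)
  have hnn : n * n₂ = D * (Y₁ ^ 2 * Y₂ ^ 2) := by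
    refine (sq_eq_sq₀ (by positivity) (by positivity)).1 ?_
    rw [mul_pow, hsq₁, hsq₂]; ring
  have hVg : v * g.toComplex = R * exp ((φ - φ₂) / 4 * I) := by
    rw [← hgR, hu, exp_neg]
    have := exp_ne_zero ((φ - φ₂) / 4 * I)
    field_simp
  refine pade_gap_contradiction (n := n) (n₂ := n₂) (φ := φ) (φ₂ := φ₂) (R := R)
    (S := Real.sqrt (2 * (Y₁ * Y₂))) (b := b) (D := D) ?_ ?_ hn0 ?_ ?_ ?_ ?_ ?_ ?_ hlt ?_ hR ?_ ?_
  · exact_mod_cast hb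
  · exact_mod_cast hD
  · rw [hsq₁]; exact_mod_cast hlarge
  · have h1 : 0 ≤ φ := by rw [hφ, arg_nonneg_iff, him, hb₁]; exact_mod_cast (by omega : 0 ≤ b)
    refine h1.lt_of_ne fun h => ?_
    have h2 := Complex.norm_mul_sin_arg x₁
    rw [← hφ, ← h, him, hb₁, Real.sin_zero, mul_zero] at h2
    have : b = 0 := by exact_mod_cast h2.symm
    omega
  · have := (abs_arg_lt_pi_div_two_iff (z := x₁)).2 (Or.inl (by rw [hre]; exact_mod_cast hξ₁))
    exact (le_abs_self _).trans this.le
  · have h2 := Complex.norm_mul_sin_arg x₁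
    rw [him, hb₁] at h2; exact h2
  · have := (abs_arg_lt_pi_div_two_iff (z := x₂)).2 (Or.inl (by rw [hre]; exact_mod_cast hξ₂))
    exact this.le
  · have h2 := Complex.norm_mul_sin_arg x₂
    rw [him] at h2
    have h3 : n₂ * |Real.sin φ₂| = |n₂ * Real.sin φ₂| := by rw [abs_mul, abs_of_pos hn20]
    rw [h3, hn2, hφ₂, h2, ← hb₂]; simp
  · have : Real.sqrt (2 * (Y₁ * Y₂)) ^ 4 = (Real.sqrt (2 * (Y₁ * Y₂)) ^ 2) ^ 2 := by ring
    rw [this, hS2, hnn]; ring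
  · exact Real.le_sqrt_of_sq_le hR2
  · intro r
    have hmem : padePoly r x₁ ((starRingEnd ℂ) x₁) * (v * g.toComplex) ∈
        GaussianInt.toComplex.range := by
      refine Subring.mul_mem _ (by rw [hx₁, ← hstar]; exact padePoly_mem_range r ξ₁) ?_
      rw [hv, ← hstar, ← map_mul, ← map_mul]
      exact ⟨_, rfl⟩
    obtain ⟨z, hz⟩ := hmem
    refine ⟨z.im, ?_⟩
    rw [← him, hz, hc₁, hVg]
    conv_rhs => rw [← he₁]
    have h1 := exp_mul_padePoly r n φ
    have h2 : exp ((φ - φ₂) / 4 * I) = exp ((φ / 4 : ℝ) * I) * exp ((-(φ₂ / 4) : ℝ) * I) := by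
      rw [← exp_add]; congr 1; push_cast; ring
    have h3 : padePoly r (n * exp (φ * I)) (n * exp (-(φ * I))) * (R * exp ((φ - φ₂) / 4 * I)) =
        ((R * n ^ r : ℝ) : ℂ) * ((padeCos r φ + padeSin r φ * I) * exp ((-(φ₂ / 4) : ℝ) * I)) := by
      rw [h2]; push_cast at h1 ⊢
      linear_combination (R : ℂ) * exp (-(φ₂ / 4) * I) * h1
    rw [h3, im_ofReal_mul, exp_mul_I, ← ofReal_cos, ← ofReal_sin]
    simp only [mul_im, add_im, add_re, mul_re, ofReal_re, ofReal_im, I_re, I_im, Real.cos_neg,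
      Real.sin_neg]
    ring

lemma sq_dvd_sub_or_add {a X Y : ℤ} {p m : ℕ} (hp : p.Prime) (hgcd : Nat.gcd a.natAbs (p ^ m) = 1)
    (hXY : IsCoprime X Y)
    (h : X ^ 2 - (a ^ 2 + (p : ℤ) ^ (2 * m)) * Y ^ 4 = -((p : ℤ) ^ (2 * m))) :
    ((p : ℤ) ^ m) ^ 2 ∣ X - a * Y ^ 2 ∨ ((p : ℤ) ^ m) ^ 2 ∣ X + a * Y ^ 2 := by
  have hpow : (p : ℤ) ^ (2 * m) = ((p : ℤ) ^ m) ^ 2 := by rw [← pow_mul, mul_comm]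
  rcases Nat.eq_zero_or_pos m with rfl | hm
  · simp
  have hprod : (X - a * Y ^ 2) * (X + a * Y ^ 2) = ((p : ℤ) ^ m) ^ 2 * (Y ^ 4 - 1) := by
    rw [hpow] at h; linear_combination h
  have hpZ : Prime (p : ℤ) := Nat.prime_iff_prime_int.mp hp
  have hcop : ∀ z : ℤ, ¬ (p : ℤ) ∣ z → IsCoprime (((p : ℤ) ^ m) ^ 2) z := fun z hz =>
    ((hpZ.coprime_iff_not_dvd.2 hz).pow_left).pow_left
  have hpa : ¬ (p : ℤ) ∣ a := by
    intro hd
    have h1 : p ∣ a.natAbs := Int.natCast_dvd.mp hd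
    have h2 : p ∣ 1 := hgcd ▸ Nat.dvd_gcd h1 (dvd_pow_self p hm.ne')
    exact hp.one_lt.ne' (Nat.dvd_one.mp h2)
  have hpb : (p : ℤ) ∣ ((p : ℤ) ^ m) ^ 2 := dvd_pow (dvd_pow_self _ hm.ne') two_ne_zero
  have hpY : ¬ (p : ℤ) ∣ Y := by
    intro hd
    have h1 : (p : ℤ) ∣ X ^ 2 := by
      have : X ^ 2 = (a ^ 2 + ((p : ℤ) ^ m) ^ 2) * Y ^ 4 - ((p : ℤ) ^ m) ^ 2 := by
        rw [hpow] at h; linear_combination h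
      rw [this]
      exact dvd_sub (Dvd.dvd.mul_left (dvd_pow hd (by norm_num)) _) hpb
    exact hpZ.not_isUnit (hXY.isUnit_of_dvd' (hpZ.dvd_of_dvd_pow h1) hd)
  by_cases h2 : p = 2
  · subst h2
    push_cast at *
    have ha2 : a % 2 = 1 := by omega
    have hY2 : Y % 2 = 1 := by omega
    have hY4 : ∃ k, Y ^ 4 - 1 = 2 * k := by
      have : Odd (Y ^ 4) := (Int.odd_iff.2 hY2).pow
      obtain ⟨k, hk⟩ := this
      exact ⟨k, by omega⟩
    obtain ⟨k, hk⟩ := hY4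
    have haY : Odd (a * Y ^ 2) := (Int.odd_iff.2 ha2).mul (Int.odd_iff.2 hY2).pow
    have hX : Odd X := by
      rw [← Int.not_even_iff_odd]
      intro hX
      have h3 : Odd ((X - a * Y ^ 2) * (X + a * Y ^ 2)) := (hX.sub_odd haY).mul (hX.add_odd haY)
      rw [hprod, hk] at h3
      have : Even (((2 : ℤ) ^ m) ^ 2 * (2 * k)) := ⟨((2 : ℤ) ^ m) ^ 2 * k, by ring⟩
      exact (Int.not_even_iff_odd.2 h3) this
    obtain ⟨e, he⟩ := hX
    obtain ⟨f, hf⟩ := haY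
    rw [hk] at hprod
    rcases Int.emod_two_eq_zero_or_one (e - f) with h4 | h4
    · left
      refine (hcop (e + f + 1) (by omega)).dvd_of_dvd_mul_right ⟨k, ?_⟩
      have : X + a * Y ^ 2 = 2 * (e + f + 1) := by rw [he, hf]; ring
      rw [this] at hprod
      linarith
    · right
      refine (hcop (e - f) (by omega)).dvd_of_dvd_mul_left ⟨k, ?_⟩
      have : X - a * Y ^ 2 = 2 * (e - f) := by rw [he, hf]; ring
      rw [this] at hprod
      linarith
  · by_cases hA : (p : ℤ) ∣ X - a * Y ^ 2
    · left
      refine (hcop (X + a * Y ^ 2) ?_).dvd_of_dvd_mul_right ⟨_, hprod⟩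
      intro hB
      have h5 : (p : ℤ) ∣ 2 * (a * Y ^ 2) := by
        have := dvd_sub hB hA
        ring_nf at this ⊢
        exact this
      rcases hpZ.dvd_mul.1 h5 with h6 | h6
      · have : p ∣ 2 := by exact_mod_cast h6
        exact h2 ((Nat.prime_dvd_prime_iff_eq hp Nat.prime_two).1 this)
      · rcases hpZ.dvd_mul.1 h6 with h7 | h7
        · exact hpa h7
        · exact hpY (hpZ.dvd_of_dvd_pow h7)
    · right
      exact (hcop _ hA).dvd_of_dvd_mul_left ⟨_, hprod⟩

lemma exists_sqrt_of_pell {D x y T U : ℤ} (hD : ¬ IsSquare D) (hneg : x ^ 2 - D * y ^ 2 = -1)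
    (hpell : T ^ 2 - D * U ^ 2 = 1) (hT : 0 < T) :
    ∃ t u : ℤ, (t ^ 2 - D * u ^ 2 = 1 ∨ t ^ 2 - D * u ^ 2 = -1) ∧
      T = t ^ 2 + D * u ^ 2 ∧ U = 2 * t * u := by
  have hD0 : 0 < D := by
    by_contra hc
    nlinarith [sq_nonneg x, mul_nonneg (neg_nonneg.2 (not_lt.1 hc)) (sq_nonneg y)]
  obtain ⟨ε, hε⟩ := Pell.IsFundamental.exists_of_not_isSquare hD0 hD
  have key : ∀ T U : ℤ, ∀ h : T ^ 2 - D * U ^ 2 = 1, 0 < T →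
      ∃ k : ℤ, (ε ^ k).x = T ∧ (ε ^ k).y = U := by
    intro T U h hT
    obtain ⟨k, hk | hk⟩ := hε.eq_zpow_or_neg_zpow (Pell.Solution₁.mk T U h)
    · exact ⟨k, by rw [← hk]; simp, by rw [← hk]; simp⟩
    · exfalso
      have h1 := congrArg Pell.Solution₁.x hk
      have h2 := Pell.Solution₁.x_zpow_pos hε.x_pos k
      simp at h1
      omega
  obtain ⟨k, hkx, hky⟩ := key T U hpell hT
  obtain ⟨j, hjx, hjy⟩ := key (x ^ 2 + D * y ^ 2) (2 * x * y)
    (by linear_combination (x ^ 2 - D * y ^ 2 - 1) * hneg)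
    (by
      have : y ≠ 0 := by rintro rfl; nlinarith [sq_nonneg x]
      positivity)
  have hdouble : ∀ l : ℤ, (ε ^ (2 * l)).x = (ε ^ l).x ^ 2 + D * (ε ^ l).y ^ 2 ∧
      (ε ^ (2 * l)).y = 2 * (ε ^ l).x * (ε ^ l).y := by
    intro l
    rw [two_mul, zpow_add, Pell.Solution₁.x_mul, Pell.Solution₁.y_mul]
    constructor <;> ring
  rcases Int.even_or_odd' k with ⟨l, hl | hl⟩
  · refine ⟨(ε ^ l).x, (ε ^ l).y, Or.inl (ε ^ l).prop, ?_, ?_⟩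
    · rw [← hkx, hl, (hdouble l).1]
    · rw [← hky, hl, (hdouble l).2]
  rcases Int.even_or_odd' j with ⟨i, hi | hi⟩
  · exfalso
    rw [hi, (hdouble i).1] at hjx
    have h1 := (ε ^ i).prop
    apply hD
    have h2 : (ε ^ i).x ^ 2 = D * y ^ 2 := by linarith
    have hy : y ≠ 0 := by rintro rfl; nlinarith [sq_nonneg x]
    have h3 : y ∣ (ε ^ i).x := by
      rw [← Int.pow_dvd_pow_iff two_ne_zero]
      exact ⟨D, by linarith⟩
    obtain ⟨r, hr⟩ := h3
    refine ⟨r, ?_⟩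
    rw [hr] at h2
    have : y ^ 2 * (D - r * r) = 0 := by linear_combination -h2
    rcases mul_eq_zero.1 this with h4 | h4
    · exact absurd h4 (pow_ne_zero 2 hy)
    · linarith
  · obtain ⟨n, hn⟩ : ∃ n : ℤ, k = j + 2 * n := ⟨l - i, by omega⟩
    have h1 := (ε ^ n).prop
    rw [hn, zpow_add, Pell.Solution₁.x_mul, hjx, hjy, (hdouble n).1, (hdouble n).2] at hkx
    rw [hn, zpow_add, Pell.Solution₁.y_mul, hjx, hjy, (hdouble n).1, (hdouble n).2] at hky
    refine ⟨x * (ε ^ n).x + D * y * (ε ^ n).y, x * (ε ^ n).y + y * (ε ^ n).x, Or.inr ?_, ?_, ?_⟩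
    · linear_combination hneg * ((ε ^ n).x ^ 2 - D * (ε ^ n).y ^ 2) - h1
    · rw [← hkx]; ring
    · rw [← hky]; ring

lemma exists_pell_param {a b D X Y x y : ℤ} (ha : 0 < a) (hb : 0 < b) (hDab : D = a ^ 2 + b ^ 2)
    (hD : ¬ IsSquare D) (hneg : x ^ 2 - D * y ^ 2 = -1) (hY : 0 < Y)
    (h : X ^ 2 - D * Y ^ 4 = -b ^ 2) (hdvd : b ^ 2 ∣ X - a * Y ^ 2 ∨ b ^ 2 ∣ X + a * Y ^ 2) :
    ∃ t u : ℤ, (t ^ 2 - D * u ^ 2 = 1 ∨ t ^ 2 - D * u ^ 2 = -1) ∧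
      Y ^ 2 = (t + u * a) ^ 2 + (b * u) ^ 2 ∧
      (X = a * (t ^ 2 + D * u ^ 2) + 2 * t * u * D ∨
        X = -(a * (t ^ 2 + D * u ^ 2) + 2 * t * u * D)) := by
  have hb2 : b ^ 2 ≠ 0 := (pow_pos hb 2).ne'
  have key : ∀ s : ℤ, s ^ 2 = 1 → b ^ 2 ∣ X - s * a * Y ^ 2 → ∃ t u : ℤ,
      (t ^ 2 - D * u ^ 2 = 1 ∨ t ^ 2 - D * u ^ 2 = -1) ∧
      Y ^ 2 = t ^ 2 + D * u ^ 2 + 2 * s * a * t * u ∧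
      X = s * a * (t ^ 2 + D * u ^ 2) + 2 * t * u * D := by
    rintro s hs ⟨U, hU⟩
    have hX' : X = s * a * Y ^ 2 + b ^ 2 * U := by linarith
    have h1 : 2 * s * a * U * Y ^ 2 + b ^ 2 * U ^ 2 = Y ^ 4 - 1 := by
      apply mul_left_cancel₀ hb2
      rw [hX', hDab] at h
      linear_combination h - (a ^ 2 * Y ^ 4) * hs
    have hpell : (Y ^ 2 - s * a * U) ^ 2 - D * U ^ 2 = 1 := by
      rw [hDab]; linear_combination -h1 + a ^ 2 * U ^ 2 * hs
    have hbT : b ^ 2 * (Y ^ 2 - s * a * U) = D * Y ^ 2 - s * a * X := by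
      rw [hX', hDab]; linear_combination (a ^ 2 * Y ^ 2) * hs
    have hT : 0 < Y ^ 2 - s * a * U := by
      have hD0 : 0 < D := by rw [hDab]; positivity
      have h2 : |s * a * X| < D * Y ^ 2 := by
        apply abs_lt_of_sq_lt_sq _ (by positivity)
        have h3 : X ^ 2 = D * Y ^ 4 - b ^ 2 := by linarith
        have h4 : (D * Y ^ 2) ^ 2 - (s * a * X) ^ 2 = b ^ 2 * (D * Y ^ 4 + a ^ 2) := by
          linear_combination (-a ^ 2 * X ^ 2) * hs - a ^ 2 * h3 + D * Y ^ 4 * hDab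
        have : 0 < b ^ 2 * (D * Y ^ 4 + a ^ 2) := by positivity
        linarith
      have h5 := (abs_lt.1 h2).2
      have h6 : 0 < b ^ 2 * (Y ^ 2 - s * a * U) := by linarith
      exact pos_of_mul_pos_right h6 (by positivity)
    obtain ⟨t, u, htu, h2, h3⟩ := exists_sqrt_of_pell hD hneg hpell hT
    refine ⟨t, u, htu, by rw [h3] at h2; linear_combination h2, ?_⟩
    rw [hX', ← h2, ← h3, hDab]
    linear_combination (a ^ 2 * U) * hs
  rcases hdvd with hd | hd
  · obtain ⟨t, u, htu, hY2, hX2⟩ := key 1 (by norm_num) (by simpa using hd)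
    refine ⟨t, u, htu, ?_, Or.inl ?_⟩
    · rw [hY2, hDab]; ring
    · rw [hX2]; ring
  · obtain ⟨t, u, htu, hY2, hX2⟩ := key (-1) (by norm_num) (by
      have : X - -1 * a * Y ^ 2 = X + a * Y ^ 2 := by ring
      rwa [this])
    refine ⟨-t, u, by simpa using htu, ?_, Or.inr ?_⟩
    · rw [hY2, hDab]; ring
    · rw [hX2]; ring

lemma isCoprime_of_param {a b D X Y t u : ℤ} (hDab : D = a ^ 2 + b ^ 2) (hXY : IsCoprime X Y)
    (htu : t ^ 2 - D * u ^ 2 = 1 ∨ t ^ 2 - D * u ^ 2 = -1)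
    (hY : Y ^ 2 = (t + u * a) ^ 2 + (b * u) ^ 2)
    (hX : X = a * (t ^ 2 + D * u ^ 2) + 2 * t * u * D ∨
      X = -(a * (t ^ 2 + D * u ^ 2) + 2 * t * u * D)) : IsCoprime (t + u * a) (b * u) := by
  have hc : IsCoprime t u := by
    rcases htu with h | h
    · exact ⟨t, -D * u, by linear_combination h⟩
    · exact ⟨-t, D * u, by linear_combination -h⟩
  have hX' : ∃ s : ℤ, X = s * (a * Y ^ 2 + 2 * t * u * b ^ 2) := by
    rcases hX with h | h
    · exact ⟨1, by rw [h, hY, hDab]; ring⟩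
    · exact ⟨-1, by rw [h, hY, hDab]; ring⟩
  refine IsCoprime.mul_right ?_ ?_
  · refine isCoprime_of_prime_dvd ?_ ?_
    · rintro ⟨h1, h2⟩
      rw [h1, h2] at hY
      have hY0 : Y = 0 := by simpa using hY
      obtain ⟨s, hs⟩ := hX'
      rw [hY0, h2] at hs
      rw [hY0, hs] at hXY
      simp only [ne_eq, OfNat.ofNat_ne_zero, not_false_eq_true, zero_pow, mul_zero, add_zero] at hXY
      exact not_isCoprime_zero_zero hXY
    · intro q hq hqc hqb
      have h1 : q ∣ Y := hq.dvd_of_dvd_pow (n := 2) (by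
        rw [hY]
        exact dvd_add (dvd_pow hqc two_ne_zero) (dvd_pow (hqb.mul_right _) two_ne_zero))
      obtain ⟨s, hs⟩ := hX'
      have h2 : q ∣ X := by
        rw [hs]
        exact Dvd.dvd.mul_left (dvd_add (Dvd.dvd.mul_left (dvd_pow h1 two_ne_zero) _)
          (Dvd.dvd.mul_left (dvd_pow hqb two_ne_zero) _)) _
      exact hq.not_isUnit (hXY.isUnit_of_dvd' h2 h1)
  · rw [mul_comm u a]
    exact (IsCoprime.add_mul_right_left_iff).2 hc

lemma exists_fourth_power_form {a b D X Y t u : ℤ} (hDab : D = a ^ 2 + b ^ 2) (hY0 : 0 < Y)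
    (hXY : IsCoprime X Y) (htu : t ^ 2 - D * u ^ 2 = 1 ∨ t ^ 2 - D * u ^ 2 = -1)
    (hY : Y ^ 2 = (t + u * a) ^ 2 + (b * u) ^ 2)
    (hX : X = a * (t ^ 2 + D * u ^ 2) + 2 * t * u * D ∨
      X = -(a * (t ^ 2 + D * u ^ 2) + 2 * t * u * D)) :
    ∃ (β σ : ℤ) (w : GaussianInt), (β = b ∨ β = -b) ∧ σ ^ 2 = 1 ∧ w.norm = Y ∧
      (⟨X, β⟩ : GaussianInt) = σ * (⟨a, -b⟩ * w ^ 4) := by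
  have hcop := isCoprime_of_param hDab hXY htu hY hX
  have hpt : PythagoreanTriple (t + u * a) (b * u) Y := by
    unfold PythagoreanTriple; linear_combination -hY
  have hsq : ∃ (τ : ℤ) (w : GaussianInt), τ ^ 2 = 1 ∧ w.norm = Y ∧
      (⟨t + u * a, b * u⟩ : GaussianInt) ^ 2 = τ * w ^ 4 := by
    obtain ⟨m, n, h1, h2, -, -⟩ := PythagoreanTriple.coprime_classification.1
      ⟨hpt, Int.isCoprime_iff_gcd_eq_one.1 hcop⟩
    have h3 : Y = m ^ 2 + n ^ 2 := by
      rcases h2 with h2 | h2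
      · exact h2
      · nlinarith [sq_nonneg m, sq_nonneg n]
    rcases h1 with ⟨h4, h5⟩ | ⟨h4, h5⟩
    · refine ⟨1, ⟨m, n⟩, by norm_num, by rw [h3, Zsqrtd.norm_def]; ring, ?_⟩
      rw [h4, h5]
      ext <;> simp [pow_succ] <;> ring
    · refine ⟨-1, ⟨m, -n⟩, by norm_num, by rw [h3, Zsqrtd.norm_def]; ring, ?_⟩
      rw [h4, h5]
      ext <;> simp [pow_succ] <;> ring
  obtain ⟨τ, w, hτ, hw, hw4⟩ := hsq
  have hexp : (⟨a, -b⟩ : GaussianInt) * ⟨t + u * a, b * u⟩ ^ 2 =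
      ⟨a * (t ^ 2 + D * u ^ 2) + 2 * t * u * D, -b * (t ^ 2 - D * u ^ 2)⟩ := by
    rw [hDab]
    ext <;> simp [pow_succ] <;> ring
  have hττ : ((τ : ℤ) : GaussianInt) * τ = 1 := by
    rw [← sq]; exact_mod_cast hτ
  rcases hX with hX | hX
  · refine ⟨-b * (t ^ 2 - D * u ^ 2), τ, w, ?_, hτ, hw, ?_⟩
    · rcases htu with h | h <;> rw [h] <;> simp
    · rw [hX, ← hexp, hw4]; ring
  · refine ⟨b * (t ^ 2 - D * u ^ 2), -τ, w, ?_, by rw [neg_sq, hτ], hw, ?_⟩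
    · rcases htu with h | h <;> rw [h] <;> simp
    · have : (⟨X, b * (t ^ 2 - D * u ^ 2)⟩ : GaussianInt) =
          -⟨a * (t ^ 2 + D * u ^ 2) + 2 * t * u * D, -b * (t ^ 2 - D * u ^ 2)⟩ := by
        rw [hX]; ext <;> simp
      rw [this, ← hexp, hw4]; push_cast; ring

lemma false_of_two_fourth_power_forms {a b D X₁ Y₁ X₂ Y₂ β₁ β₂ σ₁ σ₂ : ℤ} {w₁ w₂ : GaussianInt}
    (hb : 0 < b) (hDab : D = a ^ 2 + b ^ 2) (hX₁ : 0 < X₁) (hX₂ : 0 < X₂)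
    (hβ₁ : β₁ = b ∨ β₁ = -b) (hβ₂ : β₂ = b ∨ β₂ = -b) (hσ₁ : σ₁ ^ 2 = 1)
    (hw₁ : w₁.norm = Y₁) (hw₂ : w₂.norm = Y₂)
    (h₁ : (⟨X₁, β₁⟩ : GaussianInt) = σ₁ * (⟨a, -b⟩ * w₁ ^ 4))
    (h₂ : (⟨X₂, β₂⟩ : GaussianInt) = σ₂ * (⟨a, -b⟩ * w₂ ^ 4))
    (he₁ : X₁ ^ 2 - D * Y₁ ^ 4 = -b ^ 2) (he₂ : X₂ ^ 2 - D * Y₂ ^ 4 = -b ^ 2)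
    (hY₁ : 1 ≤ Y₁) (hY : Y₁ < Y₂) (hlarge : 1100 * b ^ 6 ≤ D * Y₁ ^ 4) : False := by
  have hσ : (⟨X₂, β₂⟩ : GaussianInt) * w₁ ^ 4 = ((σ₂ * σ₁ : ℤ) : GaussianInt) *
      (⟨X₁, β₁⟩ * w₂ ^ 4) := by
    have hss : ((σ₁ : ℤ) : GaussianInt) * σ₁ = 1 := by rw [← sq]; exact_mod_cast hσ₁
    rw [h₁, h₂]; push_cast
    linear_combination (-(σ₂ : GaussianInt) * ⟨a, -b⟩ * w₁ ^ 4 * w₂ ^ 4) * hss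
  have hD : b ^ 2 ≤ D := by rw [hDab]; nlinarith [sq_nonneg a]
  have hsq : ∀ β : ℤ, β = b ∨ β = -b → β ^ 2 = b ^ 2 ∧ |β| = b := by
    rintro β (rfl | rfl) <;> simp [hb.le]
  have hb₂ := hsq _ hβ₂
  have hb₁ := hsq _ hβ₁
  rcases hβ₁ with rfl | rfl
  · exact gaussian_gap (b := β₁) (σ := σ₂ * σ₁) (by omega) hD (ξ₁ := ⟨X₁, β₁⟩) (ξ₂ := ⟨X₂, β₂⟩) hX₁ hX₂ rfl hb₂.2 hw₁ hw₂
      (by rw [Zsqrtd.norm_def]; linear_combination he₁)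
      (by rw [Zsqrtd.norm_def]; linear_combination he₂ + hb₂.1) hσ hY₁ hY hlarge
  · refine gaussian_gap (b := b) (σ := σ₂ * σ₁) (by omega) hD (ξ₁ := star ⟨X₁, -b⟩) (ξ₂ := star ⟨X₂, β₂⟩)
      (w₁ := star w₁) (w₂ := star w₂) hX₁ hX₂ (by simp) (by simpa using hb₂.2)
      (by rw [Zsqrtd.norm_conj, hw₁]) (by rw [Zsqrtd.norm_conj, hw₂])
      (by rw [Zsqrtd.norm_conj, Zsqrtd.norm_def]; linear_combination he₁)
      (by rw [Zsqrtd.norm_conj, Zsqrtd.norm_def]; linear_combination he₂ + hb₂.1) ?_ hY₁ hY hlarge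
    rw [← star_pow, ← star_pow, ← star_mul', ← star_mul', hσ, star_mul']
    congr 1

lemma sq_eq_or_le_of_neg_one {D t u : ℤ} (h : t ^ 2 - D * u ^ 2 = -1) : u ^ 2 = 1 ∨ 25 ≤ u ^ 2 := by
  by_contra! hc
  have h1 : |u| < 5 := by
    by_contra! h2
    have := abs_mul_abs_self u
    nlinarith
  have h3 := abs_lt.1 h1
  have ht2 : t ^ 2 % 4 = 0 ∨ t ^ 2 % 4 = 1 := by
    rcases Int.emod_two_eq_zero_or_one t with h | h
    · left; obtain ⟨k, hk⟩ : ∃ k, t = 2 * k := ⟨t / 2, by omega⟩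
      rw [hk]; ring_nf; omega
    · right; obtain ⟨k, hk⟩ : ∃ k, t = 2 * k + 1 := ⟨t / 2, by omega⟩
      rw [hk]; ring_nf; omega
  have ht3 : t ^ 2 % 3 = 0 ∨ t ^ 2 % 3 = 1 := by
    obtain ⟨k, hk | hk | hk⟩ : ∃ k, t = 3 * k ∨ t = 3 * k + 1 ∨ t = 3 * k + 2 :=
      ⟨t / 3, by omega⟩ <;> rw [hk] <;> ring_nf <;> omega
  obtain ⟨h4, h5⟩ := h3
  interval_cases u <;> omega

lemma size_of_five_le {a b D Y t u : ℤ} (ha : 0 < a) (hb : 0 < b) (hDab : D = a ^ 2 + b ^ 2)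
    (h : t ^ 2 - D * u ^ 2 = -1) (hu : 25 ≤ u ^ 2)
    (hY : Y ^ 2 = (t + u * a) ^ 2 + (b * u) ^ 2) : 1100 * b ^ 6 ≤ D * Y ^ 4 := by
  have hb2 : 0 < b ^ 2 := by positivity
  have hb4 : 0 < b ^ 4 := by positivity
  have hbu : 25 * b ^ 2 ≤ (b * u) ^ 2 := by rw [mul_pow]; nlinarith
  have fin : ∀ k l : ℤ, 0 ≤ k → k * b ^ 2 ≤ 1000 * Y ^ 2 → l * b ^ 2 ≤ 1000 * D →
      1100000000000 ≤ k ^ 2 * l → 1100 * b ^ 6 ≤ D * Y ^ 4 := by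
    intro k l hk h1 h2 h3
    have h4 : (k * b ^ 2) ^ 2 ≤ (1000 * Y ^ 2) ^ 2 := pow_le_pow_left₀ (by positivity) h1 2
    have hD : 0 < D := by rw [hDab]; positivity
    have h5 : (k * b ^ 2) ^ 2 * (l * b ^ 2) ≤ (1000 * Y ^ 2) ^ 2 * (1000 * D) :=
      (mul_le_mul_of_nonneg_left h2 (by positivity)).trans
        (mul_le_mul_of_nonneg_right h4 (by positivity))
    have h6 : 1100000000000 * b ^ 6 ≤ (k ^ 2 * l) * b ^ 6 :=
      mul_le_mul_of_nonneg_right h3 (by positivity)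
    nlinarith
  have gap : ∀ κ : ℤ, 0 ≤ κ → 200 * κ * a ≤ (9900 - κ ^ 2) * b → 2 ≤ b →
      (250000 + 25 * κ ^ 2) * b ^ 2 ≤ 10000 * Y ^ 2 := by
    intro κ hκ h1 h2
    have hv := abs_nonneg u
    have hv2 : |u| ^ 2 = u ^ 2 := sq_abs u
    have hs2 : |t| ^ 2 = t ^ 2 := sq_abs t
    have h3 : (|u| * (100 * a + κ * b)) ^ 2 ≤ (100 * |t|) ^ 2 := by
      have e1 : t ^ 2 = D * u ^ 2 - 1 := by linarith
      rw [mul_pow, mul_pow, hv2, hs2, e1, hDab]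
      have e2 : 200 * κ * a * b ≤ (9900 - κ ^ 2) * b * b := mul_le_mul_of_nonneg_right h1 hb.le
      have e3 : u ^ 2 * (200 * κ * a * b) ≤ u ^ 2 * ((9900 - κ ^ 2) * b * b) :=
        mul_le_mul_of_nonneg_left e2 (sq_nonneg u)
      have e4 : 10000 ≤ 100 * (b ^ 2 * u ^ 2) := by nlinarith
      nlinarith
    have h4 : |u| * (100 * a + κ * b) ≤ 100 * |t| :=
      le_of_sq_le_sq h3 (by positivity)
    have h5 : |t| - |u| * a ≤ |t + u * a| := by
      have := abs_sub_abs_le_abs_sub t (-(u * a))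
      rw [abs_neg, abs_mul, abs_of_pos ha, sub_neg_eq_add] at this
      exact this
    have h6 : |u| * (κ * b) ≤ 100 * |t + u * a| := by linarith
    have h7 : (|u| * (κ * b)) ^ 2 ≤ (100 * |t + u * a|) ^ 2 :=
      pow_le_pow_left₀ (by positivity) h6 2
    rw [mul_pow, mul_pow, mul_pow, hv2, sq_abs] at h7
    have h8 : 25 * (κ ^ 2 * b ^ 2) ≤ u ^ 2 * (κ ^ 2 * b ^ 2) :=
      mul_le_mul_of_nonneg_right hu (by positivity)
    rw [hY]; linarith
  by_cases c1 : 76 * b ^ 2 ≤ 100 * a ^ 2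
  · refine fin 25000 1760 (by norm_num) ?_ (by rw [hDab]; linarith) (by norm_num)
    rw [hY]; nlinarith [sq_nonneg (t + u * a)]
  push Not at c1
  have hb' : 2 ≤ b := by
    by_contra! hc
    have : b = 1 := by omega
    subst this
    nlinarith
  by_cases c2 : 24 * b ^ 2 ≤ 100 * a ^ 2
  · have h1 : 10 * a < 9 * b := by nlinarith
    have := gap 44 (by norm_num) (by linarith) hb'
    exact fin 29840 1240 (by norm_num) (by linarith) (by rw [hDab]; linarith) (by norm_num)
  · have h1 : 2 * a < b := by nlinarith
    have := gap 60 (by norm_num) (by linarith) hb'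
    exact fin 34000 1000 (by norm_num) (by linarith) (by rw [hDab]; nlinarith) (by norm_num)

lemma size_of_large {a b D Y : ℤ} (hb : 9 ≤ b) (hDab : D = a ^ 2 + b ^ 2)
    (hba : b ^ 2 = 4 * a + 5) (hYa : Y = 2 * a + 3) : 1100 * b ^ 6 ≤ D * Y ^ 4 := by
  obtain ⟨B, hB⟩ : ∃ B, B = b ^ 2 := ⟨_, rfl⟩
  have h81 : 81 ≤ B := by rw [hB]; nlinarith
  have hD : B ^ 2 ≤ 20 * D := by
    rw [hDab, ← hB]
    have : B = 4 * a + 5 := by rw [hB, hba]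
    nlinarith
  have hY4 : B ^ 4 ≤ (2 * Y) ^ 4 := pow_le_pow_left₀ (by omega) (by omega) 4
  have h10 : B ^ 2 * B ^ 4 ≤ (20 * D) * (2 * Y) ^ 4 :=
    mul_le_mul hD hY4 (by positivity) (by rw [hDab]; positivity)
  have h11 : 81 ^ 3 * B ^ 3 ≤ B ^ 3 * B ^ 3 :=
    mul_le_mul_of_nonneg_right (pow_le_pow_left₀ (by norm_num) h81 3) (by positivity)
  have h12 : 1100 * b ^ 6 = 1100 * B ^ 3 := by rw [hB]; ring
  have h13 : 0 ≤ B ^ 3 := by positivity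
  rw [h12]
  linarith

lemma size_of_unit_one {a b D Y : ℤ} {p m : ℕ} (hp : p.Prime) (hbp : b = (p : ℤ) ^ m) (ha : 0 < a)
    (hcop : IsCoprime a b) (hDab : D = a ^ 2 + b ^ 2) (hY1 : 1 < Y) {t : ℤ}
    (h : t ^ 2 + 1 = D) (hY : Y ^ 2 = (t + a) ^ 2 + b ^ 2) :
    1100 * b ^ 6 ≤ D * Y ^ 4 ∨ (a = 1 ∧ b = 3) ∨ (a = 11 ∧ b = 7) ∨ (a = 1 ∧ b = 4) := by
  have hpZ : Prime (p : ℤ) := Nat.prime_iff_prime_int.mp hp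
  have hb : 0 < b := by rw [hbp]; exact pow_pos (by exact_mod_cast hp.pos) m
  obtain ⟨c, hc⟩ : ∃ c, c = t + a := ⟨_, rfl⟩
  have ht : t = c - a := by omega
  rw [← hc] at hY
  have hcd : c * (c - 2 * a) = b ^ 2 - 1 := by rw [ht, hDab] at h; linear_combination h
  have hC2 : |c| ^ 2 = c ^ 2 := sq_abs c
  have hprod : (Y - |c|) * (Y + |c|) = b ^ 2 := by linear_combination hY - hC2
  have hC0 : 0 ≤ |c| := abs_nonneg c
  have hlt : 0 < Y - |c| := by
    by_contra! hh
    nlinarith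
  have hc0 : c ≠ 0 := by
    rintro rfl
    have : b = 1 := by nlinarith
    subst this
    have : Y ^ 2 = 1 := by rw [hY]; norm_num
    nlinarith
  have hCpos : 0 < |c| := abs_pos.2 hc0
  rcases Nat.eq_zero_or_pos m with rfl | hm
  · exfalso
    have hb1 : b = 1 := by simpa using hbp
    rw [hb1] at hprod
    nlinarith
  obtain ⟨n, rfl⟩ : ∃ n, m = n + 1 := ⟨m - 1, by omega⟩
  have hpb : (p : ℤ) ∣ b := hbp ▸ dvd_pow_self _ hm.ne'
  have hpc : ¬ (p : ℤ) ∣ |c| := by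
    rw [dvd_abs]
    intro hd
    have h1 : (p : ℤ) ∣ b ^ 2 - c * (c - 2 * a) :=
      dvd_sub (dvd_pow hpb two_ne_zero) (hd.mul_right _)
    rw [hcd, sub_sub_cancel] at h1
    exact hpZ.not_isUnit (isUnit_of_dvd_one h1)
  have hunit : ∀ z w : ℤ, ∀ r : ℕ, 0 < z → ¬ (p : ℤ) ∣ z → z * w = (p : ℤ) ^ r → z = 1 := by
    intro z w r hz hpz hzw
    have h1 : IsCoprime z ((p : ℤ) ^ r) := ((hpZ.coprime_iff_not_dvd.2 hpz).pow_left).symm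
    have h2 : IsUnit z := h1.isUnit_of_dvd' dvd_rfl ⟨w, hzw.symm⟩
    rcases Int.isUnit_iff.1 h2 with h3 | h3 <;> omega
  by_cases h2 : p = 2
  · subst h2
    push_cast at *
    have hb' : b = 2 * 2 ^ n := by rw [hbp]; ring
    have hYC : ∃ e, Y - |c| = 2 * e := by
      have h1 : Even (Y ^ 2 + |c| ^ 2) := ⟨|c| ^ 2 + 2 * (2 ^ n) ^ 2, by rw [hC2, hY, hb']; ring⟩
      rcases Int.even_or_odd Y with hh | hh
      · exfalso
        have : Odd (|c| ^ 2) := (Int.odd_iff.2 (by omega)).pow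
        exact Int.not_even_iff_odd.2 ((hh.pow_of_ne_zero two_ne_zero).add_odd this) h1
      · obtain ⟨k, hk⟩ := hh
        exact ⟨(Y - |c|) / 2, by omega⟩
    obtain ⟨e, he⟩ := hYC
    have hef : e * (e + |c|) = 2 ^ (2 * n) := by
      have h3 : (Y - |c|) * (Y + |c|) = 4 * (e * (e + |c|)) := by
        have : Y + |c| = 2 * (e + |c|) := by omega
        rw [this, he]; ring
      rw [hprod, hb'] at h3
      rw [pow_mul, ← pow_mul, mul_comm 2 n, pow_mul]
      linarith
    have he1 : e = 1 := by
      rcases Int.emod_two_eq_zero_or_one e with h3 | h3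
      · have := hunit (e + |c|) e (2 * n) (by omega) (by omega) (by linarith)
        omega
      · exact hunit e (e + |c|) (2 * n) (by omega) (by omega) (by linarith)
    have hbC : b ^ 2 = 4 * (1 + |c|) := by
      rw [← hprod]
      have : Y + |c| = 2 * (1 + |c|) := by omega
      rw [this, he, he1]; ring
    have hd3 : |c| ∣ 3 := by
      rw [abs_dvd]
      rcases abs_choice c with h4 | h4
      · exact ⟨c - 2 * a - 4, by linarith⟩
      · exact ⟨c - 2 * a + 4, by linarith⟩
    have hC3 : |c| ≤ 3 := Int.le_of_dvd (by norm_num) hd3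
    have hbsq : b ≤ 4 := by nlinarith
    right; right; right
    have hb4 : b = 4 := by
      have : |c| ≠ 2 := by intro h5; rw [h5] at hd3; norm_num at hd3
      interval_cases b <;> omega
    refine ⟨?_, hb4⟩
    rw [hb4] at hbC hcd
    have : |c| = 3 := by omega
    rcases abs_choice c with h4 | h4
    · have : c = 3 := by omega
      subst this; omega
    · have : c = -3 := by omega
      subst this; omega
  · have hp2 : ¬ (p : ℤ) ∣ 2 := by
      intro hd
      exact h2 ((Nat.prime_dvd_prime_iff_eq hp Nat.prime_two).1 (by exact_mod_cast hd))
    have hbr : b ^ 2 = (p : ℤ) ^ (2 * (n + 1)) := by rw [hbp, ← pow_mul, mul_comm]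
    have hY' : Y - |c| = 1 := by
      by_cases h3 : (p : ℤ) ∣ Y - |c|
      · have h4 : ¬ (p : ℤ) ∣ Y + |c| := by
          intro h5
          have h6 : (p : ℤ) ∣ 2 * |c| := by
            have := dvd_sub h5 h3
            ring_nf at this ⊢; exact this
          rcases hpZ.dvd_mul.1 h6 with h7 | h7
          · exact hp2 h7
          · exact hpc h7
        have := hunit (Y + |c|) (Y - |c|) _ (by omega) h4 (by rw [← hbr, ← hprod, mul_comm])
        omega
      · exact hunit (Y - |c|) (Y + |c|) _ hlt h3 (by rw [← hbr, ← hprod])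
    have hbC : b ^ 2 = 2 * |c| + 1 := by
      rw [← hprod, hY']; omega
    have hca : c - 2 * a = 2 ∧ 0 < c := by
      rcases abs_choice c with h4 | h4
      · refine ⟨mul_left_cancel₀ hc0 ?_, by omega⟩
        linarith
      · exfalso
        have : c - 2 * a = -2 := mul_left_cancel₀ hc0 (by linarith)
        omega
    obtain ⟨h5, h6⟩ := hca
    have hba : b ^ 2 = 4 * a + 5 := by rw [abs_of_pos h6] at hbC; omega
    have hYa : Y = 2 * a + 3 := by rw [abs_of_pos h6] at hY'; omega
    by_cases hb9 : b < 9
    · right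
      interval_cases b
      · omega
      · omega
      · left; omega
      · omega
      · exfalso
        have : a = 5 := by omega
        rw [this] at hcop
        norm_num [isCoprime_self, Int.isUnit_iff] at hcop
      · omega
      · right; left; omega
      · omega
    · left
      push Not at hb9
      exact size_of_large hb9 hDab hba hYa

lemma size_five {t u Y : ℤ} (hu0 : u ≠ 0) (hY1 : 1 < Y) (h : t ^ 2 - 5 * u ^ 2 = 1)
    (hY : Y ^ 2 = (t + u) ^ 2 + (2 * u) ^ 2) : 144 ≤ Y ^ 2 := by
  by_contra! hlt
  have h1 : u ^ 2 < 6 ^ 2 := by linarith [sq_nonneg (t + u)]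
  have h2 : t ^ 2 < 14 ^ 2 := by linarith
  have h3 : Y ^ 2 < 12 ^ 2 := by linarith
  obtain ⟨h4, h5⟩ := abs_lt.1 (abs_lt_of_sq_lt_sq h1 (by norm_num))
  obtain ⟨h6, h7⟩ := abs_lt.1 (abs_lt_of_sq_lt_sq h2 (by norm_num))
  obtain ⟨-, h8⟩ := abs_lt.1 (abs_lt_of_sq_lt_sq h3 (by norm_num))
  clear hlt h1 h2 h3
  interval_cases u <;> first | omega | (interval_cases t <;> first | omega |
    (interval_cases Y <;> omega))

lemma size_two {t u Y : ℤ} (hu0 : u ≠ 0) (hY1 : 1 < Y) (h : t ^ 2 - 2 * u ^ 2 = 1)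
    (hY : Y ^ 2 = (t + u) ^ 2 + u ^ 2) : 25 ≤ Y ^ 2 := by
  by_contra! hlt
  have h1 : u ^ 2 < 5 ^ 2 := by linarith [sq_nonneg (t + u)]
  have h2 : t ^ 2 < 8 ^ 2 := by linarith
  have h3 : Y ^ 2 < 5 ^ 2 := by linarith
  obtain ⟨h4, h5⟩ := abs_lt.1 (abs_lt_of_sq_lt_sq h1 (by norm_num))
  obtain ⟨h6, h7⟩ := abs_lt.1 (abs_lt_of_sq_lt_sq h2 (by norm_num))
  obtain ⟨-, h8⟩ := abs_lt.1 (abs_lt_of_sq_lt_sq h3 (by norm_num))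
  clear hlt h1 h2 h3
  interval_cases u <;> first | omega | (interval_cases t <;> first | omega |
    (interval_cases Y <;> omega))

lemma size_of_norm_one {a b D Y t u : ℤ} (ha : 0 < a) (hb : 0 < b)
    (hcop : IsCoprime a b) (hDab : D = a ^ 2 + b ^ 2) (hD : ¬ IsSquare D) {x y : ℤ}
    (hneg : x ^ 2 - D * y ^ 2 = -1) (hY1 : 1 < Y)
    (h : t ^ 2 - D * u ^ 2 = 1) (hY : Y ^ 2 = (t + u * a) ^ 2 + (b * u) ^ 2) :
    1100 * b ^ 6 ≤ D * Y ^ 4 := by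
  have hD2 : b ^ 2 + 1 ≤ D := by rw [hDab]; nlinarith
  have hu0 : u ≠ 0 := by
    rintro rfl
    have : Y ^ 2 = 1 := by rw [hY]; linarith
    nlinarith
  have ht0 : t ≠ 0 := by
    rintro rfl
    nlinarith [sq_nonneg u]
  obtain ⟨t', u', h', hT, hU⟩ := exists_sqrt_of_pell (T := |t|) (U := u) hD hneg
    (by rw [sq_abs]; exact h) (abs_pos.2 ht0)
  have hu' : 1 ≤ u' ^ 2 := by
    have : u' ≠ 0 := by rintro rfl; simp at hU; exact hu0 hU
    have := pow_pos (abs_pos.2 this) 2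
    rw [sq_abs] at this
    omega
  have ht' : D - 1 ≤ t' ^ 2 := by
    rcases h' with h' | h' <;> nlinarith
  have hu2 : 4 * (D - 1) ≤ u ^ 2 := by
    rw [hU]
    have : (D - 1) * 1 ≤ t' ^ 2 * u' ^ 2 := mul_le_mul ht' hu' (by norm_num) (sq_nonneg _)
    nlinarith
  have hYb : b ^ 2 * (4 * (D - 1)) ≤ Y ^ 2 := by
    have := mul_le_mul_of_nonneg_left hu2 (sq_nonneg b)
    rw [hY]; nlinarith [sq_nonneg (t + u * a)]
  have hYb4 : (b ^ 2 * (4 * (D - 1))) ^ 2 ≤ (Y ^ 2) ^ 2 :=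
    pow_le_pow_left₀ (by nlinarith) hYb 2
  have hfin : 1100 * b ^ 2 ≤ 16 * (D * (D - 1) ^ 2) → 1100 * b ^ 6 ≤ D * Y ^ 4 := by
    intro h1
    have h2 := mul_le_mul_of_nonneg_left hYb4 (by nlinarith : 0 ≤ D)
    have h3 := mul_le_mul_of_nonneg_left h1 (by positivity : 0 ≤ b ^ 4)
    nlinarith
  by_cases hb3 : 3 ≤ b
  · apply hfin
    have h1 : b ^ 2 ≤ D - 1 := by omega
    have h2 : (b ^ 2) ^ 2 ≤ (D - 1) ^ 2 := pow_le_pow_left₀ (by positivity) h1 2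
    have h3 : b ^ 2 * (b ^ 2) ^ 2 ≤ D * (D - 1) ^ 2 :=
      mul_le_mul (by omega) h2 (by positivity) (by nlinarith)
    have h4 : (3 : ℤ) ^ 4 ≤ b ^ 4 := pow_le_pow_left₀ (by norm_num) hb3 4
    have h5 := mul_le_mul_of_nonneg_left h4 (sq_nonneg b)
    nlinarith
  push Not at hb3
  have hab : (b = 2 ∧ a = 1) ∨ (b = 1 ∧ a = 1) ∨ (b = 2 ∧ 3 ≤ a) ∨ (b = 1 ∧ 2 ≤ a) := by
    by_cases h2 : b = 2 ∧ a = 2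
    · rw [h2.1, h2.2] at hcop
      norm_num [isCoprime_self, Int.isUnit_iff] at hcop
    · omega
  rcases hab with ⟨rfl, rfl⟩ | ⟨rfl, rfl⟩ | ⟨rfl, h3⟩ | ⟨rfl, h3⟩
  · norm_num at hDab
    subst hDab
    have := size_five hu0 hY1 h (by rw [hY]; ring)
    have := pow_le_pow_left₀ (by norm_num) this 2
    linarith
  · norm_num at hDab
    subst hDab
    have := size_two hu0 hY1 h (by rw [hY]; ring)
    have := pow_le_pow_left₀ (by norm_num) this 2
    linarith
  · apply hfin
    have : 13 ≤ D := by rw [hDab]; nlinarith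
    nlinarith [mul_le_mul this (pow_le_pow_left₀ (by norm_num) (by omega : 12 ≤ D - 1) 2) (by norm_num) (by omega)]
  · apply hfin
    have : 5 ≤ D := by rw [hDab]; nlinarith
    nlinarith [mul_le_mul this (pow_le_pow_left₀ (by norm_num) (by omega : 4 ≤ D - 1) 2) (by norm_num) (by omega)]

lemma size_or_exceptional {a b D Y t u : ℤ} {p m : ℕ} (hp : p.Prime) (hbp : b = (p : ℤ) ^ m)
    (ha : 0 < a) (hcop : IsCoprime a b) (hDab : D = a ^ 2 + b ^ 2) (hD : ¬ IsSquare D) {x y : ℤ}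
    (hneg : x ^ 2 - D * y ^ 2 = -1) (hY1 : 1 < Y)
    (h : t ^ 2 - D * u ^ 2 = 1 ∨ t ^ 2 - D * u ^ 2 = -1)
    (hY : Y ^ 2 = (t + u * a) ^ 2 + (b * u) ^ 2) :
    1100 * b ^ 6 ≤ D * Y ^ 4 ∨ (a = 1 ∧ b = 3) ∨ (a = 11 ∧ b = 7) ∨ (a = 1 ∧ b = 4) := by
  have hb : 0 < b := by rw [hbp]; exact pow_pos (by exact_mod_cast hp.pos) m
  rcases h with h | h
  · exact Or.inl (size_of_norm_one ha hb hcop hDab hD hneg hY1 h hY)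
  rcases sq_eq_or_le_of_neg_one h with hu | hu
  · refine size_of_unit_one hp hbp ha hcop hDab hY1 (t := t * u) ?_ ?_
    · linear_combination h + (t ^ 2 + D) * hu
    · rw [hY]; linear_combination (a ^ 2 + b ^ 2 - t ^ 2) * hu
  · exact Or.inl (size_of_five_le ha hb hDab h hu hY)

section PellPowers

open NumberTheorySymbols

lemma jacobiSym_ne_neg_one_of_sq_modEq {Y z : ℤ} {Q : ℕ} (h : Y ^ 2 ≡ z [ZMOD Q]) :
    J(z | Q) ≠ -1 := by
  rw [← jacobiSym.mod_left' h, jacobiSym.pow_left]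
  have := sq_nonneg (J(Y | Q))
  omega

lemma Pell.Solution₁.zpow_mul_modEq {d : ℤ} {g : Pell.Solution₁ d} {Q : ℤ} (hx : g.x ≡ 1 [ZMOD Q])
    (hy : g.y ≡ 0 [ZMOD Q]) (j : ℤ) (w : Pell.Solution₁ d) :
    (g ^ j * w).x ≡ w.x [ZMOD Q] ∧ (g ^ j * w).y ≡ w.y [ZMOD Q] := by
  have step : ∀ g : Pell.Solution₁ d, g.x ≡ 1 [ZMOD Q] → g.y ≡ 0 [ZMOD Q] →
      ∀ w : Pell.Solution₁ d, (g * w).x ≡ w.x [ZMOD Q] ∧ (g * w).y ≡ w.y [ZMOD Q] := by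
    intro g hx hy w
    rw [x_mul, y_mul]
    constructor
    · have := (hx.mul_right w.x).add ((hy.mul_right w.y).mul_left d)
      simpa using this
    · have := (hx.mul_right w.y).add (hy.mul_right w.x)
      simpa using this
  induction j using Int.induction_on generalizing w with
  | zero => simp
  | succ i ih =>
    rw [zpow_add_one, mul_assoc]
    exact ⟨(ih _).1.trans (step g hx hy w).1, (ih _).2.trans (step g hx hy w).2⟩
  | pred i ih =>
    rw [zpow_sub_one, mul_assoc]
    have := step g⁻¹ (by rwa [x_inv]) (by rw [y_inv]; simpa using hy.neg) w
    exact ⟨(ih _).1.trans this.1, (ih _).2.trans this.2⟩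

lemma Pell.Solution₁.x_sq {d : ℤ} (g : Pell.Solution₁ d) : (g ^ 2).x = 2 * g.x ^ 2 - 1 := by
  rw [sq, x_mul]; linear_combination -g.prop

lemma Pell.Solution₁.y_sq {d : ℤ} (g : Pell.Solution₁ d) : (g ^ 2).y = 2 * g.x * g.y := by
  rw [sq, y_mul]; ring

lemma Pell.Solution₁.x_pow_three {d : ℤ} (g : Pell.Solution₁ d) :
    (g ^ 3).x = 4 * g.x ^ 3 - 3 * g.x := by
  rw [pow_succ, x_mul, x_sq, y_sq]; linear_combination (-2 * g.x) * g.prop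

lemma Pell.Solution₁.y_pow_three {d : ℤ} (g : Pell.Solution₁ d) :
    (g ^ 3).y = g.y * (4 * g.x ^ 2 - 1) := by
  rw [pow_succ, y_mul, x_sq, y_sq]; ring

lemma Pell.Solution₁.x_pow_five {d : ℤ} (g : Pell.Solution₁ d) :
    (g ^ 5).x = 16 * g.x ^ 5 - 20 * g.x ^ 3 + 5 * g.x := by
  rw [show g ^ 5 = g ^ 3 * g ^ 2 from pow_add g 3 2, x_mul, x_sq, y_sq, x_pow_three, y_pow_three]
  linear_combination (-2 * g.x * (4 * g.x ^ 2 - 1)) * g.prop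

lemma Pell.Solution₁.x_pow_seven {d : ℤ} (g : Pell.Solution₁ d) :
    (g ^ 7).x = 64 * g.x ^ 7 - 112 * g.x ^ 5 + 56 * g.x ^ 3 - 7 * g.x := by
  rw [show g ^ 7 = g ^ 3 * (g ^ 2) ^ 2 by rw [← pow_mul, ← pow_add], x_mul, x_sq, y_sq, x_sq, y_sq,
    x_pow_three, y_pow_three]
  linear_combination (-4 * g.x * (4 * g.x ^ 2 - 1) * (2 * g.x ^ 2 - 1)) * g.prop

lemma jacobiSym_y_x_eq_one {d : ℤ} (g : Pell.Solution₁ d) (hodd : Odd g.x) (hpos : 0 < g.x) :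
    ∃ Q : ℕ, (g ^ 4).x = Q ∧ Q % 8 = 1 ∧ J((g ^ 4).y | Q) = 1 := by
  obtain ⟨e, he⟩ := hodd
  obtain ⟨H, hH⟩ : ∃ H : ℕ, (g ^ 2).x = H := by
    refine ⟨((g ^ 2).x).toNat, (Int.toNat_of_nonneg ?_).symm⟩
    rw [Pell.Solution₁.x_sq]; nlinarith
  have hg4 : g ^ 4 = (g ^ 2) ^ 2 := by rw [← pow_mul]
  have hH1 : 1 ≤ (H : ℤ) := by rw [← hH, Pell.Solution₁.x_sq]; nlinarith
  have hH4 : (H : ℤ) % 4 = 1 := by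
    rw [← hH, Pell.Solution₁.x_sq, he]; ring_nf; omega
  obtain ⟨Q, hQ⟩ : ∃ Q : ℕ, (g ^ 4).x = Q := by
    refine ⟨((g ^ 4).x).toNat, (Int.toNat_of_nonneg ?_).symm⟩
    rw [hg4, Pell.Solution₁.x_sq, hH]; nlinarith
  have hQH : (Q : ℤ) = 2 * H ^ 2 - 1 := by rw [← hQ, hg4, Pell.Solution₁.x_sq, hH]
  have hQ8 : Q % 8 = 1 := by
    obtain ⟨f, hf⟩ : ∃ f, (H : ℤ) = 4 * f + 1 := ⟨H / 4, by omega⟩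
    have : (Q : ℤ) % 8 = 1 := by rw [hQH, hf]; ring_nf; omega
    omega
  have hQodd : Odd Q := Nat.odd_iff.2 (by omega)
  refine ⟨Q, hQ, hQ8, ?_⟩
  rw [hg4, Pell.Solution₁.y_sq, hH, jacobiSym.mul_left, jacobiSym.mul_left]
  have h2 : J(2 | Q) = 1 := by
    rw [jacobiSym.at_two hQodd, ZMod.χ₈_nat_eq_if_mod_eight]; simp [hQ8]; omega
  have h3 : J((H : ℤ) | Q) = 1 := by
    have hHodd : Odd H := Nat.odd_iff.2 (by omega)
    rw [jacobiSym.quadratic_reciprocity_one_mod_four' hHodd (by omega),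
      jacobiSym.mod_left' (a₂ := -1) (Int.modEq_iff_dvd.2 ⟨-(2 * H), by rw [hQH]; ring⟩),
      jacobiSym.at_neg_one hHodd, ZMod.χ₄_nat_one_mod_four (by omega)]
  have h4 : J((g ^ 2).y | Q) = 1 := by
    rw [jacobiSym.mod_right _ hQodd]
    have h5 : (Q : ℤ) = 1 + 4 * (g ^ 2).y * (d * g.x * g.y) := by
      rw [hQH, ← hH, Pell.Solution₁.x_sq, Pell.Solution₁.y_sq]
      linear_combination (8 * g.x ^ 2) * g.prop
    have h6 : 1 ≡ Q [MOD (4 * (g ^ 2).y.natAbs)] := by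
      rw [Nat.modEq_iff_dvd, h5]
      push_cast
      exact ⟨(g ^ 2).y.sign * (d * g.x * g.y), by
        linear_combination (-4 * (d * g.x * g.y)) * Int.sign_mul_abs (g ^ 2).y⟩
    rw [← h6, ← jacobiSym.mod_right _ odd_one, jacobiSym.one_right]
  rw [h2, h3, h4]; norm_num

lemma jacobiSym_ne_of_order_four {d a : ℤ} (g w : Pell.Solution₁ d) (hodd : Odd g.x)
    (hpos : 0 < g.x) {n Y : ℤ} (hn : Odd n)
    (hY : Y ^ 2 = (w * (g ^ 4) ^ n).x + a * (w * (g ^ 4) ^ n).y) {r : ℕ} (hr : Odd r)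
    (hrw : a * w.x + d * w.y = r ∨ a * w.x + d * w.y = -r) : J((g ^ 4).x | r) ≠ -1 := by
  obtain ⟨Q, hQ, hQ8, hJ⟩ := jacobiSym_y_x_eq_one g hodd hpos
  have hQodd : Odd Q := Nat.odd_iff.2 (by omega)
  have hm1 : J(-1 | Q) = 1 := by
    rw [jacobiSym.at_neg_one hQodd, ZMod.χ₄_nat_one_mod_four (by omega)]
  have hf0 : (g ^ 4).x ≡ 0 [ZMOD Q] := by rw [hQ]; simp [Int.ModEq]
  have h4x : ((g ^ 4) ^ 4).x ≡ 1 [ZMOD Q] := by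
    rw [show (g ^ 4) ^ 4 = ((g ^ 4) ^ 2) ^ 2 from pow_mul _ 2 2, Pell.Solution₁.x_sq,
      Pell.Solution₁.x_sq]
    have := (((((hf0.pow 2).mul_left 2).sub_right 1).pow 2).mul_left 2).sub_right 1
    simpa using this
  have h4y : ((g ^ 4) ^ 4).y ≡ 0 [ZMOD Q] := by
    rw [show (g ^ 4) ^ 4 = ((g ^ 4) ^ 2) ^ 2 from pow_mul _ 2 2, Pell.Solution₁.y_sq,
      Pell.Solution₁.y_sq]
    have := (((hf0.mul_left 2).mul_right (g ^ 4).y).mul_left (2 * ((g ^ 4) ^ 2).x))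
    simpa using this
  have key : ∃ s : ℤ, (s = 1 ∨ s = -1) ∧ Y ^ 2 ≡ s * ((a * w.x + d * w.y) * (g ^ 4).y) [ZMOD Q] := by
    obtain ⟨i, hi | hi⟩ : ∃ i, n = 4 * i + 1 ∨ n = 4 * i + -1 := by
      obtain ⟨i, hi⟩ := hn
      rcases Int.even_or_odd' i with ⟨l, hl | hl⟩
      · exact ⟨l, by omega⟩
      · exact ⟨l + 1, by omega⟩
    · have e1 : w * (g ^ 4) ^ n = ((g ^ 4) ^ 4) ^ i * (w * g ^ 4) := by
        rw [hi, zpow_add, zpow_mul, zpow_one, ← mul_assoc, ← mul_assoc, mul_comm w]; rfl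
      obtain ⟨hx, hy⟩ := Pell.Solution₁.zpow_mul_modEq h4x h4y i (w * g ^ 4)
      refine ⟨1, Or.inl rfl, ?_⟩
      rw [hY, e1]
      refine (hx.add (hy.mul_left a)).trans ?_
      rw [Pell.Solution₁.x_mul, Pell.Solution₁.y_mul]
      have := ((hf0.mul_left w.x).add_right (d * (w.y * (g ^ 4).y))).add
        (((hf0.mul_left w.y).add_left (w.x * (g ^ 4).y)).mul_left a)
      refine this.trans ?_
      unfold Int.ModEq
      congr 1
      ring
    · have e1 : w * (g ^ 4) ^ n = ((g ^ 4) ^ 4) ^ i * (w * (g ^ 4)⁻¹) := by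
        rw [hi, zpow_add, zpow_mul, zpow_neg_one, ← mul_assoc, ← mul_assoc, mul_comm w]; rfl
      obtain ⟨hx, hy⟩ := Pell.Solution₁.zpow_mul_modEq h4x h4y i (w * (g ^ 4)⁻¹)
      refine ⟨-1, Or.inr rfl, ?_⟩
      rw [hY, e1]
      refine (hx.add (hy.mul_left a)).trans ?_
      rw [Pell.Solution₁.x_mul, Pell.Solution₁.y_mul, Pell.Solution₁.x_inv, Pell.Solution₁.y_inv]
      have := ((hf0.mul_left w.x).add_right (d * (w.y * -(g ^ 4).y))).add
        (((hf0.mul_left w.y).add_left (w.x * -(g ^ 4).y)).mul_left a)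
      refine this.trans ?_
      unfold Int.ModEq
      congr 1
      ring
  obtain ⟨s, hs, hYs⟩ := key
  have h1 := jacobiSym_ne_neg_one_of_sq_modEq hYs
  have hsJ : J(s | Q) = 1 := by
    rcases hs with rfl | rfl
    · exact jacobiSym.one_left Q
    · exact hm1
  have hrJ : J(a * w.x + d * w.y | Q) = J((r : ℤ) | Q) := by
    rcases hrw with h | h <;> rw [h]
    rw [jacobiSym.neg _ hQodd, ZMod.χ₄_nat_one_mod_four (by omega), one_mul]
  rw [jacobiSym.mul_left, jacobiSym.mul_left, hsJ, hJ, hrJ, one_mul, mul_one,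
    jacobiSym.quadratic_reciprocity_one_mod_four' hr (by omega), ← hQ] at h1
  exact h1

lemma Pell.Solution₁.exists_zpow_eq {d : ℤ} {ε : Pell.Solution₁ d} (hε : Pell.IsFundamental ε)
    {T U : ℤ} (h : T ^ 2 - d * U ^ 2 = 1) (hT : 0 < T) :
    ∃ k : ℤ, (ε ^ k).x = T ∧ (ε ^ k).y = U := by
  obtain ⟨k, hk | hk⟩ := hε.eq_zpow_or_neg_zpow (Pell.Solution₁.mk T U h)
  · exact ⟨k, by rw [← hk]; simp, by rw [← hk]; simp⟩
  · exfalso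
    have h1 := congrArg Pell.Solution₁.x hk
    have h2 := Pell.Solution₁.x_zpow_pos hε.x_pos k
    simp at h1
    omega

lemma Int.exists_pow_mul_and_not_dvd {k : ℤ} (hk : k ≠ 0) {q : ℕ} (hq : q ≠ 1) :
    ∃ (s : ℕ) (n : ℤ), ¬ (q : ℤ) ∣ n ∧ k = q ^ s * n := by
  obtain ⟨n, h, hn⟩ := (Int.finiteMultiplicity_iff.2
    ⟨by simpa using hq, hk⟩ : FiniteMultiplicity (q : ℤ) k).exists_eq_pow_mul_and_not_dvd
  exact ⟨_, n, hn, h⟩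

lemma Int.exists_two_pow_mul_odd {k : ℤ} (hk : k ≠ 0) :
    ∃ (s : ℕ) (n : ℤ), Odd n ∧ k = 2 ^ s * n := by
  obtain ⟨s, n, hn, h⟩ := Int.exists_pow_mul_and_not_dvd hk (q := 2) (by norm_num)
  exact ⟨s, n, by rw [Int.odd_iff]; omega, h⟩

lemma false_of_order_four {d a : ℤ} {ε : Pell.Solution₁ d} (hpos : 0 < ε.x)
    (hx : ε.x ≡ 1 [ZMOD 2]) (hy : ε.y ≡ 0 [ZMOD 2]) {k k₀ Y : ℤ}
    (hY : Y ^ 2 = (ε ^ k).x + a * (ε ^ k).y) (hk : k ≠ k₀) {r : ℕ} (hr : Odd r)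
    (hr₀ : a * (ε ^ k₀).x + d * (ε ^ k₀).y = r ∨ a * (ε ^ k₀).x + d * (ε ^ k₀).y = -r)
    {L : List ℕ} (hodd : ∀ M ∈ L, Odd M) (hdvd : ∀ M ∈ L, (4 * M : ℤ) ∣ k - k₀)
    (hL : ∀ s : ℕ, ∃ M ∈ L, J((ε ^ (4 * 2 ^ s * M)).x | r) = -1) : False := by
  have h4 : (4 : ℤ) ∣ k - k₀ := by
    obtain ⟨M, hM, -⟩ := hL 0
    exact (dvd_mul_right _ _).trans (hdvd M hM)
  obtain ⟨l, hl⟩ := h4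
  obtain ⟨s, n, hn, hsn⟩ := Int.exists_two_pow_mul_odd (k := l) (by rintro rfl; omega)
  obtain ⟨M, hM, hJ⟩ := hL s
  have hMn : (M : ℤ) ∣ n := by
    have h1 : (M : ℤ) ∣ 2 ^ s * n := by
      rw [← hsn]
      have := hdvd M hM
      rw [hl] at this
      exact Int.dvd_of_mul_dvd_mul_left (by norm_num) this
    refine IsCoprime.dvd_of_dvd_mul_left ?_ h1
    refine IsCoprime.pow_right ?_
    rw [Int.isCoprime_iff_gcd_eq_one]
    exact (Nat.coprime_two_right).2 (hodd M hM)
  obtain ⟨n', hn'⟩ := hMn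
  rw [hn'] at hn
  have hodd' : Odd (ε ^ (2 ^ s * M)).x := by
    have := (Pell.Solution₁.zpow_mul_modEq hx hy ((2 ^ s * M : ℕ) : ℤ) 1).1
    rw [mul_one, zpow_natCast] at this
    rw [Int.odd_iff]
    exact this
  refine jacobiSym_ne_of_order_four (ε ^ (2 ^ s * M)) (ε ^ k₀) hodd' (Pell.Solution₁.x_pow_pos hpos _)
    (Int.odd_mul.1 hn).2 (n := n') (Y := Y) (a := a) ?_ hr hr₀ ?_
  · have : ε ^ k = ε ^ k₀ * ((ε ^ (2 ^ s * M)) ^ 4) ^ n' := by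
      rw [← zpow_natCast ε, ← zpow_natCast (ε ^ _), ← zpow_mul, ← zpow_mul, ← zpow_add]
      congr 1
      push_cast
      linear_combination hl + 4 * hsn + 4 * 2 ^ s * hn'
    rw [hY, this]
  · rw [← pow_mul]
    convert hJ using 4
    ring

lemma x_pow_mod_mem {d : ℤ} {ε : Pell.Solution₁ d} {m : ℤ} {L : List ℤ} (h0 : (ε ^ 4).x % m ∈ L)
    (hstep : ∀ r ∈ L, (2 * r ^ 2 - 1) % m ∈ L) (s : ℕ) : (ε ^ (4 * 2 ^ s)).x % m ∈ L := by
  induction s with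
  | zero => simpa using h0
  | succ s ih =>
    rw [pow_succ, ← mul_assoc, pow_mul, Pell.Solution₁.x_sq]
    have h1 : (2 * ((ε ^ (4 * 2 ^ s)).x % m) ^ 2 - 1) ≡ 2 * (ε ^ (4 * 2 ^ s)).x ^ 2 - 1 [ZMOD m] :=
      (((Int.mod_modEq _ m).pow 2).mul_left 2).sub_right 1
    have h2 := hstep _ ih
    rwa [h1] at h2

/-- The coordinates of the `n`-th power of `T + U * √D`, reduced modulo `q`. -/
def pellMod (q D T U : ℕ) : ℕ → ℕ × ℕ
  | 0 => (1 % q, 0)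
  | n + 1 => ((T * (pellMod q D T U n).1 + D * U * (pellMod q D T U n).2) % q,
      (T * (pellMod q D T U n).2 + U * (pellMod q D T U n).1) % q)

lemma pellMod_modEq {q D T U : ℕ} {ε : Pell.Solution₁ (D : ℤ)} (hT : ε.x = T) (hU : ε.y = U)
    (n : ℕ) : (ε ^ n).x ≡ (pellMod q D T U n).1 [ZMOD q] ∧
      (ε ^ n).y ≡ (pellMod q D T U n).2 [ZMOD q] := by
  induction n with
  | zero => simp [pellMod, Int.ModEq]
  | succ n ih =>
    rw [pow_succ', Pell.Solution₁.x_mul, Pell.Solution₁.y_mul, hT, hU]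
    simp only [pellMod]
    push_cast
    constructor
    · refine Int.ModEq.trans ?_ (Int.mod_modEq _ _).symm
      rw [mul_assoc]
      exact (ih.1.mul_left _).add ((ih.2.mul_left _).mul_left _)
    · refine Int.ModEq.trans ?_ (Int.mod_modEq _ _).symm
      exact (ih.2.mul_left _).add (ih.1.mul_left _)

lemma pow_half_ne_of_sq_modEq {q v : ℕ} (hq : q.Prime) (hq3 : 3 ≤ q) {Y : ℤ}
    (h : Y ^ 2 ≡ v [ZMOD q]) : v ^ ((q - 1) / 2) % q ≠ q - 1 := by
  intro hv
  have := Fact.mk hq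
  have h1 : ((v : ℕ) : ZMod q) ^ ((q - 1) / 2) = -1 := by
    have : ((v ^ ((q - 1) / 2) : ℕ) : ZMod q) = ((q - 1 : ℕ) : ZMod q) := by
      rw [← ZMod.natCast_mod, hv]
    rw [Nat.cast_pow, Nat.cast_sub (by omega)] at this
    simpa using this
  have h2 : ((v : ℕ) : ZMod q) = (Y : ZMod q) ^ 2 := by
    have := (ZMod.intCast_eq_intCast_iff _ _ _).2 h
    push_cast at this
    exact this.symm
  have heven : 2 * ((q - 1) / 2) = q - 1 := by
    have := hq.eq_two_or_odd
    omega
  rw [h2, ← pow_mul, heven] at h1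
  have hne : (1 : ZMod q) ≠ -1 := by
    have : Fact (2 < q) := ⟨by omega⟩
    exact (ZMod.neg_one_ne_one).symm
  by_cases hY : (Y : ZMod q) = 0
  · rw [hY, zero_pow (by omega)] at h1
    exact one_ne_zero (neg_eq_zero.1 h1.symm)
  · rw [ZMod.pow_card_sub_one_eq_one hY] at h1
    exact hne h1

lemma pellMod_sieve {D T U a H : ℕ} {ε : Pell.Solution₁ (D : ℤ)} (hT : ε.x = T) (hU : ε.y = U)
    {L : List ℕ} (hprime : ∀ q ∈ L, q.Prime ∧ 3 ≤ q) (hper : ∀ q ∈ L, pellMod q D T U H = (1, 0))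
    {k : ℤ} {r : ℕ} (hr : k ≡ r [ZMOD H]) {Y : ℤ} (hY : Y ^ 2 = (ε ^ k).x + a * (ε ^ k).y) :
    ∀ q ∈ L, ((pellMod q D T U r).1 + a * (pellMod q D T U r).2) ^ ((q - 1) / 2) % q ≠ q - 1 := by
  intro q hq
  obtain ⟨hp, hq3⟩ := hprime q hq
  refine pow_half_ne_of_sq_modEq hp hq3 (Y := Y) ?_
  have hH := pellMod_modEq (q := q) hT hU H
  rw [hper q hq] at hH
  obtain ⟨j, hj⟩ := hr.symm.dvd
  have h1 : ε ^ k = (ε ^ H) ^ j * ε ^ r := by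
    rw [← zpow_natCast, ← zpow_natCast, ← zpow_mul, ← zpow_add]
    congr 1; omega
  have h2 := Pell.Solution₁.zpow_mul_modEq (by simpa using hH.1) (by simpa using hH.2) j (ε ^ r)
  have h3 := pellMod_modEq (q := q) hT hU r
  rw [hY, h1]
  push_cast
  exact (h2.1.trans h3.1).add ((h2.2.trans h3.2).mul_left _)

lemma isFundamental_of_forall {D T U : ℕ} {ε : Pell.Solution₁ (D : ℤ)} (hD : 0 < D)
    (hT : ε.x = T) (hU : ε.y = U) (hU0 : 0 < U)
    (h : ∀ y < U, y ≠ 0 → Nat.sqrt (D * y ^ 2 + 1) ^ 2 ≠ D * y ^ 2 + 1) : Pell.IsFundamental ε := by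
  have hprop := ε.prop
  rw [hT, hU] at hprop
  refine ⟨?_, by rw [hU]; exact_mod_cast hU0, ?_⟩
  · rw [hT]
    have : (1 : ℤ) ≤ D * U ^ 2 := by exact_mod_cast Nat.succ_le_of_lt (by positivity)
    nlinarith
  · intro b hb
    by_contra! hlt
    have hbp := b.prop
    rw [hT] at hlt
    have hy : (b.y.natAbs : ℤ) ^ 2 = b.y ^ 2 := Int.natAbs_sq _
    have hx : (b.x.natAbs : ℤ) ^ 2 = b.x ^ 2 := Int.natAbs_sq _
    have hD' : (0 : ℤ) < D := by exact_mod_cast hD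
    have h1 : b.y.natAbs < U := by
      have : (b.y.natAbs : ℤ) ^ 2 < U ^ 2 := by
        rw [hy]
        have : (D : ℤ) * b.y ^ 2 < D * U ^ 2 := by nlinarith
        exact lt_of_mul_lt_mul_left this hD'.le
      exact_mod_cast lt_of_pow_lt_pow_left₀ 2 (by positivity) this
    have h2 : b.y.natAbs ≠ 0 := by
      intro h0
      rw [h0] at hy
      have : b.y ^ 2 = 0 := by rw [← hy]; norm_num
      rw [this] at hbp
      nlinarith
    refine h _ h1 h2 ?_
    have h3 : D * b.y.natAbs ^ 2 + 1 = b.x.natAbs ^ 2 := by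
      have : (D : ℤ) * b.y.natAbs ^ 2 + 1 = b.x.natAbs ^ 2 := by rw [hy, hx]; linarith
      exact_mod_cast this
    rw [h3, sq b.x.natAbs, Nat.sqrt_eq]
    ring

lemma Pell.Solution₁.zpow_odd_modEq {d : ℤ} (w : Pell.Solution₁ d) {n : ℤ} (hn : Odd n) :
    ∃ δ e : ℤ, (δ = 1 ∨ δ = -1) ∧ (e = 1 ∨ e = -1) ∧ (w ^ n).x ≡ δ * w.x [ZMOD (w ^ 2).x] ∧
      (w ^ n).y ≡ δ * (e * w.y) [ZMOD (w ^ 2).x] := by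
  have h0 : (w ^ 2).x ≡ 0 [ZMOD (w ^ 2).x] := by simp [Int.ModEq]
  have h4x : (w ^ 4).x ≡ -1 [ZMOD (w ^ 2).x] := by
    rw [show w ^ 4 = (w ^ 2) ^ 2 from pow_mul _ 2 2, x_sq (w ^ 2)]
    simpa using ((h0.pow 2).mul_left 2).sub_right 1
  have h4y : (w ^ 4).y ≡ 0 [ZMOD (w ^ 2).x] := by
    rw [show w ^ 4 = (w ^ 2) ^ 2 from pow_mul _ 2 2, y_sq (w ^ 2)]
    simpa using (h0.mul_left 2).mul_right (w ^ 2).y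
  have h8x : (w ^ 8).x ≡ 1 [ZMOD (w ^ 2).x] := by
    rw [show w ^ 8 = (w ^ 4) ^ 2 from pow_mul _ 4 2, x_sq (w ^ 4)]
    simpa using ((h4x.pow 2).mul_left 2).sub_right 1
  have h8y : (w ^ 8).y ≡ 0 [ZMOD (w ^ 2).x] := by
    rw [show w ^ 8 = (w ^ 4) ^ 2 from pow_mul _ 4 2, y_sq (w ^ 4)]
    simpa using (h4y.mul_left (2 * (w ^ 4).x))
  have key : ∀ (j : ℤ) (v : Pell.Solution₁ d), w ^ n = (w ^ 8) ^ j * v →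
      (w ^ n).x ≡ v.x [ZMOD (w ^ 2).x] ∧ (w ^ n).y ≡ v.y [ZMOD (w ^ 2).x] := fun j v h ↦ by
    rw [h]; exact zpow_mul_modEq h8x h8y j v
  have h4 : ∀ v : Pell.Solution₁ d, (w ^ 4 * v).x ≡ -1 * v.x [ZMOD (w ^ 2).x] ∧
      (w ^ 4 * v).y ≡ -1 * v.y [ZMOD (w ^ 2).x] := fun v ↦ by
    rw [x_mul, y_mul]
    constructor
    · simpa using (h4x.mul_right v.x).add ((h4y.mul_right v.y).mul_left d)
    · simpa using (h4x.mul_right v.y).add (h4y.mul_right v.x)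
  have hmod : n % 8 = 1 ∨ n % 8 = 3 ∨ n % 8 = 5 ∨ n % 8 = 7 := by
    rw [Int.odd_iff] at hn; omega
  have hsplit : ∀ j c : ℤ, n = 8 * j + c → w ^ n = (w ^ 8) ^ j * w ^ c := fun j c h ↦ by
    rw [h, zpow_add, zpow_mul]; rfl
  rcases hmod with h | h | h | h
  · refine ⟨1, 1, .inl rfl, .inl rfl, ?_⟩
    simpa using key (n / 8) w (by simpa using hsplit (n / 8) 1 (by omega))
  · refine ⟨-1, -1, .inr rfl, .inr rfl, ?_⟩
    have := key (n / 8) (w ^ 4 * w⁻¹) (by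
      rw [hsplit (n / 8) (4 + -1) (by omega), zpow_add, zpow_neg_one]; rfl)
    have h := h4 w⁻¹
    rw [x_inv, y_inv] at h
    exact ⟨this.1.trans h.1, by simpa using this.2.trans h.2⟩
  · refine ⟨-1, 1, .inr rfl, .inl rfl, ?_⟩
    have := key (n / 8) (w ^ 4 * w) (by
      rw [hsplit (n / 8) (4 + 1) (by omega), zpow_add, zpow_one]; rfl)
    exact ⟨this.1.trans (h4 w).1, by simpa using this.2.trans (h4 w).2⟩
  · refine ⟨1, -1, .inl rfl, .inr rfl, ?_⟩
    simpa using key (n / 8 + 1) w⁻¹ (by simpa using hsplit (n / 8 + 1) (-1) (by omega))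

lemma pow_two_pow_mod_mem {d : ℤ} {ε : Pell.Solution₁ d} {m : ℤ} {L : List (ℤ × ℤ)} {N : ℕ}
    (h0 : ((ε ^ N).x % m, (ε ^ N).y % m) ∈ L)
    (hstep : ∀ r ∈ L, ((2 * r.1 ^ 2 - 1) % m, 2 * r.1 * r.2 % m) ∈ L) (s : ℕ) :
    ((ε ^ (N * 2 ^ s)).x % m, (ε ^ (N * 2 ^ s)).y % m) ∈ L := by
  induction s with
  | zero => simpa using h0
  | succ s ih =>
    rw [pow_succ, ← mul_assoc, pow_mul, Pell.Solution₁.x_sq, Pell.Solution₁.y_sq]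
    have hx := Int.mod_modEq (ε ^ (N * 2 ^ s)).x m
    have hy := Int.mod_modEq (ε ^ (N * 2 ^ s)).y m
    have h2 := hstep _ ih
    have h3 : (2 * ((ε ^ (N * 2 ^ s)).x % m) ^ 2 - 1) % m = _ :=
      ((hx.pow 2).mul_left 2).sub_right 1
    have h4 : 2 * ((ε ^ (N * 2 ^ s)).x % m) * ((ε ^ (N * 2 ^ s)).y % m) % m = _ :=
      (hx.mul_left 2).mul hy
    rwa [h3, h4] at h2

lemma Pell.Solution₁.x_pow_three_modEq {d m c : ℤ} {g : Pell.Solution₁ d} (h : g.x ≡ c [ZMOD m]) :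
    (g ^ 3).x ≡ 4 * c ^ 3 - 3 * c [ZMOD m] := by
  rw [x_pow_three]; gcongr

lemma Pell.Solution₁.x_pow_five_modEq {d m c : ℤ} {g : Pell.Solution₁ d} (h : g.x ≡ c [ZMOD m]) :
    (g ^ 5).x ≡ 16 * c ^ 5 - 20 * c ^ 3 + 5 * c [ZMOD m] := by
  rw [x_pow_five]; gcongr

lemma Pell.Solution₁.x_pow_seven_modEq {d m c : ℤ} {g : Pell.Solution₁ d} (h : g.x ≡ c [ZMOD m]) :
    (g ^ 7).x ≡ 64 * c ^ 7 - 112 * c ^ 5 + 56 * c ^ 3 - 7 * c [ZMOD m] := by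
  rw [x_pow_seven]; gcongr

lemma pell_ten_four_dvd {ε : Pell.Solution₁ (10 : ℕ)} (hx : ε.x = 19) (hy : ε.y = 6) {k Y : ℤ}
    (hY : Y ^ 2 = (ε ^ k).x + (1 : ℕ) * (ε ^ k).y) (h4 : 4 ∣ k) : k = 0 := by
  by_contra hk
  obtain ⟨l, rfl⟩ := h4
  obtain ⟨s, n, hn, rfl⟩ := Int.exists_two_pow_mul_odd (k := l) (by rintro rfl; simp at hk)
  set w := ε ^ (4 * 2 ^ s) with hw
  have hwn : ε ^ (4 * (2 ^ s * n)) = w ^ n := by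
    rw [hw, ← zpow_natCast, ← zpow_mul]
    congr 1; push_cast; ring
  obtain ⟨δ, e, hδ, he, h1, h2⟩ := w.zpow_odd_modEq hn
  have hmem : (w.x % 44, w.y % 44) ∈ ([(5, 8), (5, 36)] : List (ℤ × ℤ)) := by
    refine pow_two_pow_mod_mem (N := 4) ?_ ?_ s
    · rw [show ε ^ 4 = (ε ^ 2) ^ 2 from pow_mul _ 2 2]
      simp only [Pell.Solution₁.x_sq, Pell.Solution₁.y_sq, hx, hy]
      decide
    · decide
  have hpos : 0 < w.x := Pell.Solution₁.x_pow_pos (by rw [hx]; norm_num) _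
  have hprop := w.prop
  push_cast at hprop
  have hQw : (w ^ 2).x = w.x ^ 2 + 10 * w.y ^ 2 := by
    rw [w.x_sq]; linear_combination hprop
  obtain ⟨Q, hQ⟩ : ∃ Q : ℕ, (w ^ 2).x = Q := Int.eq_ofNat_of_zero_le (by rw [hQw]; positivity)
  have he2 : e ^ 2 = 1 := by rcases he with rfl | rfl <;> norm_num
  have hvpos : 0 < w.x + e * w.y := by
    have : |e * w.y| < w.x := abs_lt_of_sq_lt_sq (by rw [mul_pow, he2]; nlinarith) hpos.le
    linarith [neg_abs_le (e * w.y)]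
  obtain ⟨v, hv⟩ := Int.eq_ofNat_of_zero_le hvpos.le
  have hv44 : v % 44 = 13 ∨ v % 44 = 41 := by
    simp only [List.mem_cons, Prod.mk.injEq, List.not_mem_nil, or_false] at hmem
    rcases he with rfl | rfl <;> omega
  have hQ4 : Q % 4 = 1 := by
    have hx4 : w.x ≡ 1 [ZMOD 4] := by
      simp only [List.mem_cons, Prod.mk.injEq, List.not_mem_nil, or_false] at hmem
      unfold Int.ModEq; omega
    have h := ((hx4.pow 2).mul_left 2).sub_right 1
    rw [← w.x_sq, hQ] at h
    have : (Q : ℤ) % 4 = 1 := h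
    omega
  have hQodd : Odd Q := Nat.odd_iff.2 (by omega)
  have hcop : IsCoprime w.y v := by
    rw [← hv]
    exact ⟨-e * w.x - 10 * w.y, w.x, by linear_combination hprop⟩
  refine jacobiSym_ne_neg_one_of_sq_modEq (Y := Y) (z := δ * v) (Q := Q) ?_ ?_
  · rw [hY, hwn, ← hQ, ← hv]
    refine (h1.add (h2.mul_left _)).trans ?_
    unfold Int.ModEq; congr 1; push_cast; ring
  · have hδJ : J(δ | Q) = 1 := by
      rcases hδ with rfl | rfl
      · exact jacobiSym.one_left Q
      · rw [jacobiSym.at_neg_one hQodd, ZMod.χ₄_nat_one_mod_four hQ4]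
    have hQv : (Q : ℤ) ≡ 11 * w.y ^ 2 [ZMOD v] := by
      refine (Int.modEq_iff_dvd.2 ⟨w.x - e * w.y, ?_⟩).symm
      rw [← hv, ← hQ, hQw]
      linear_combination w.y ^ 2 * he2
    have h11 : J(v | 11) = -1 := by
      rw [jacobiSym.mod_left]
      have : (v : ℤ) % (11 : ℕ) = 2 ∨ (v : ℤ) % (11 : ℕ) = 8 := by omega
      rcases this with h | h <;> rw [h] <;> norm_num
    rw [jacobiSym.mul_left, hδJ, one_mul,
      jacobiSym.quadratic_reciprocity_one_mod_four (by omega) hQodd, jacobiSym.mod_left' hQv,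
      jacobiSym.mul_left, jacobiSym.pow_left, jacobiSym.sq_one (Int.isCoprime_iff_gcd_eq_one.1 hcop),
      mul_one, ← h11]
    exact (jacobiSym.quadratic_reciprocity_one_mod_four (by omega) (by decide)).symm

lemma pell_ten_eq_zero_or_one {ε : Pell.Solution₁ (10 : ℕ)} (hx : ε.x = 19) (hy : ε.y = 6)
    {k Y : ℤ} (hY : Y ^ 2 = (ε ^ k).x + (1 : ℕ) * (ε ^ k).y) : k = 0 ∨ k = 1 := by
  obtain ⟨r, hr⟩ := Int.eq_ofNat_of_zero_le (Int.emod_nonneg k (by norm_num : (60 : ℤ) ≠ 0))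
  have hsieve := pellMod_sieve (H := 60) (L := [19, 131, 7019]) hx hy
    (by norm_num) (by decide +kernel) (show k ≡ r [ZMOD (60 : ℕ)] by
      rw [← hr]; exact (Int.mod_modEq k 60).symm) hY
  have hdec : ∀ r < 60, (∀ q ∈ [19, 131, 7019], ((pellMod q 10 19 6 r).1 +
      1 * (pellMod q 10 19 6 r).2) ^ ((q - 1) / 2) % q ≠ q - 1) → r % 4 = 0 ∨ r = 1 := by
    decide +kernel
  rcases hdec r (by omega) hsieve with h | h
  · exact .inl (pell_ten_four_dvd hx hy hY (by omega))
  · right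
    by_contra hk
    refine false_of_order_four (r := 79) (L := [3, 15]) (by rw [hx]; norm_num) (by rw [hx]; rfl)
      (by rw [hy]; rfl) hY hk (by decide) (.inl (by simp [hx, hy])) (by decide)
      (by simp; omega) fun s ↦ ?_
    have hmem := x_pow_mod_mem (ε := ε) (m := 79)
      (L := [41, 43, 63, 37, 51, 66, 21, 12, 50, 22, 19, 10]) (by
        rw [show ε ^ 4 = (ε ^ 2) ^ 2 from pow_mul _ 2 2]
        simp only [Pell.Solution₁.x_sq, hx]
        decide) (by decide) s
    have hJ : ∀ c ∈ ([41, 43, 63, 37, 51, 66, 21, 12, 50, 22, 19, 10] : List ℤ),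
        J(4 * c ^ 3 - 3 * c | 79) = -1 ∨ J(16 * (4 * c ^ 3 - 3 * c) ^ 5 -
          20 * (4 * c ^ 3 - 3 * c) ^ 3 + 5 * (4 * c ^ 3 - 3 * c) | 79) = -1 := by
      simp only [List.forall_mem_cons, List.not_mem_nil, IsEmpty.forall_iff, implies_true, and_true]
      norm_num
    have h3 := Pell.Solution₁.x_pow_three_modEq (Int.mod_modEq (ε ^ (4 * 2 ^ s)).x 79).symm
    rcases hJ _ hmem with h | h
    · exact ⟨3, by simp, by rw [pow_mul, ← h]; exact jacobiSym.mod_left' h3⟩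
    · refine ⟨15, by simp, ?_⟩
      rw [pow_mul, show (15 : ℕ) = 3 * 5 from rfl, pow_mul, ← h]
      exact jacobiSym.mod_left' (Pell.Solution₁.x_pow_five_modEq h3)

lemma pell_one_hundred_seventy_eq_zero_or_one {ε : Pell.Solution₁ (170 : ℕ)} (hx : ε.x = 339)
    (hy : ε.y = 26) {k Y : ℤ} (hY : Y ^ 2 = (ε ^ k).x + (11 : ℕ) * (ε ^ k).y) : k = 0 ∨ k = 1 := by
  obtain ⟨r, hr⟩ := Int.eq_ofNat_of_zero_le (Int.emod_nonneg k (by norm_num : (84 : ℤ) ≠ 0))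
  have hsieve := pellMod_sieve (H := 84) (L := [3, 41, 43, 73, 251]) hx hy
    (by norm_num) (by decide +kernel) (show k ≡ r [ZMOD (84 : ℕ)] by
      rw [← hr]; exact (Int.mod_modEq k 84).symm) hY
  have hdec : ∀ r < 84, (∀ q ∈ [3, 41, 43, 73, 251], ((pellMod q 170 339 26 r).1 +
      11 * (pellMod q 170 339 26 r).2) ^ ((q - 1) / 2) % q ≠ q - 1) → r = 0 ∨ r = 1 := by
    decide +kernel
  have hfour : ε ^ 4 = (ε ^ 2) ^ 2 := pow_mul _ 2 2
  rcases hdec r (by omega) hsieve with h | h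
  · left
    by_contra hk
    refine false_of_order_four (r := 11) (L := [1, 3]) (by rw [hx]; norm_num) (by rw [hx]; rfl)
      (by rw [hy]; rfl) hY hk (by decide) (.inl (by simp)) (by decide)
      (by simp; omega) fun s ↦ ?_
    have hmem := x_pow_mod_mem (ε := ε) (m := 11) (L := [9, 7]) (by
        rw [hfour]
        simp only [Pell.Solution₁.x_sq, hx]
        decide) (by decide) s
    have hJ : ∀ c ∈ ([9, 7] : List ℤ), J(c | 11) = -1 ∨ J(4 * c ^ 3 - 3 * c | 11) = -1 := by
      simp only [List.forall_mem_cons, List.not_mem_nil, IsEmpty.forall_iff, implies_true, and_true]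
      norm_num
    have h1 := (Int.mod_modEq (ε ^ (4 * 2 ^ s)).x 11).symm
    rcases hJ _ hmem with h | h
    · exact ⟨1, by simp, by rw [mul_one, ← h]; exact jacobiSym.mod_left' h1⟩
    · refine ⟨3, by simp, ?_⟩
      rw [pow_mul, ← h]
      exact jacobiSym.mod_left' (Pell.Solution₁.x_pow_three_modEq h1)
  · right
    by_contra hk
    refine false_of_order_four (r := 8149) (L := [7]) (by rw [hx]; norm_num) (by rw [hx]; rfl)
      (by rw [hy]; rfl) hY hk (by decide) (.inl (by simp [hx, hy])) (by decide)
      (by simp; omega) fun s ↦ ?_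
    have hmem := x_pow_mod_mem (ε := ε) (m := 8149)
      (L := [5354, 2416, 4743, 1468, 7375, 248, 772, 2213, 7788, 8022, 7810, 1669]) (by
        rw [hfour]
        simp only [Pell.Solution₁.x_sq, hx]
        decide) (by decide) s
    have hJ : ∀ c ∈ ([5354, 2416, 4743, 1468, 7375, 248, 772, 2213, 7788, 8022, 7810, 1669] :
        List ℤ), J(64 * c ^ 7 - 112 * c ^ 5 + 56 * c ^ 3 - 7 * c | 8149) = -1 := by
      simp only [List.forall_mem_cons, List.not_mem_nil, IsEmpty.forall_iff, implies_true, and_true]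
      norm_num
    refine ⟨7, by simp, ?_⟩
    rw [pow_mul, ← hJ _ hmem]
    exact jacobiSym.mod_left' (Pell.Solution₁.x_pow_seven_modEq
      (Int.mod_modEq (ε ^ (4 * 2 ^ s)).x 8149).symm)

lemma pell_seventeen_exists_sqrt {ε : Pell.Solution₁ (17 : ℕ)} (hx : ε.x = 33) (hy : ε.y = 8)
    (s : ℕ) : ∃ t u : ℤ, (ε ^ (3 * 3 ^ s)).x = t ^ 2 + 17 * u ^ 2 ∧ (ε ^ (3 * 3 ^ s)).y = 2 * t * u ∧
      t ^ 2 - 17 * u ^ 2 = -1 ∧ t % 4 = 0 ∧ u % 4 = 1 ∧ u % 5 = 0 ∧ 0 < u := by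
  induction s with
  | zero =>
    refine ⟨268, 65, ?_, ?_, by norm_num⟩
    · rw [pow_zero, mul_one, Pell.Solution₁.x_pow_three, hx]; norm_num
    · rw [pow_zero, mul_one, Pell.Solution₁.y_pow_three, hx, hy]; norm_num
  | succ s ih =>
    obtain ⟨t, u, h1, h2, h3, ht4, hu4, hu5, hu⟩ := ih
    have hprop := (ε ^ (3 * 3 ^ s)).prop
    push_cast at hprop
    have hu' : 3 * t ^ 2 * u + 17 * u ^ 3 = u * (68 * u ^ 2 - 3) := by
      linear_combination 3 * u * h3
    refine ⟨t ^ 3 + 51 * t * u ^ 2, 3 * t ^ 2 * u + 17 * u ^ 3, ?_, ?_, ?_, ?_, ?_, ?_, ?_⟩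
    · rw [pow_succ, ← mul_assoc, pow_mul, Pell.Solution₁.x_pow_three]
      rw [h1, h2] at *
      linear_combination 3 * (t ^ 2 + 17 * u ^ 2) * hprop
    · rw [pow_succ, ← mul_assoc, pow_mul, Pell.Solution₁.y_pow_three]
      rw [h1, h2] at *
      linear_combination (2 * t * u) * hprop
    · linear_combination ((t ^ 2 - 17 * u ^ 2) ^ 2 - (t ^ 2 - 17 * u ^ 2) + 1) * h3
    · refine Int.emod_eq_zero_of_dvd ?_
      exact dvd_add (dvd_pow (Int.dvd_of_emod_eq_zero ht4) (by norm_num))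
        (((Int.dvd_of_emod_eq_zero ht4).mul_left _).mul_right _)
    · have : u * (68 * u ^ 2 - 3) = 4 * (u * (17 * u ^ 2 - 1)) + u := by ring
      rw [hu', this]; omega
    · rw [hu']
      exact Int.emod_eq_zero_of_dvd ((Int.dvd_of_emod_eq_zero hu5).mul_right _)
    · positivity

lemma Pell.Solution₁.zpow_modEq_of_not_three_dvd {d : ℤ} (w : Pell.Solution₁ d) {n : ℤ}
    (hn : ¬ 3 ∣ n) : ∃ e : ℤ, (e = 1 ∨ e = -1) ∧ (w ^ n).x ≡ w.x [ZMOD 2 * w.x + 1] ∧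
      (w ^ n).y ≡ e * w.y [ZMOD 2 * w.x + 1] := by
  have h3x : (w ^ 3).x ≡ 1 [ZMOD 2 * w.x + 1] := by
    rw [x_pow_three]
    exact (Int.modEq_iff_dvd.2 ⟨(w.x - 1) * (2 * w.x + 1), by ring⟩).symm
  have h3y : (w ^ 3).y ≡ 0 [ZMOD 2 * w.x + 1] := by
    rw [y_pow_three]
    exact (Int.modEq_iff_dvd.2 ⟨w.y * (2 * w.x - 1), by ring⟩).symm
  have key : ∀ j c : ℤ, n = 3 * j + c → (w ^ n).x ≡ (w ^ c).x [ZMOD 2 * w.x + 1] ∧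
      (w ^ n).y ≡ (w ^ c).y [ZMOD 2 * w.x + 1] := fun j c h ↦ by
    have : w ^ n = (w ^ 3) ^ j * w ^ c := by rw [h, zpow_add, zpow_mul]; rfl
    rw [this]; exact zpow_mul_modEq h3x h3y j _
  rcases (by omega : n % 3 = 1 ∨ n % 3 = 2) with h | h
  · exact ⟨1, .inl rfl, by simpa using key (n / 3) 1 (by omega)⟩
  · exact ⟨-1, .inr rfl, by simpa using key (n / 3 + 1) (-1) (by omega)⟩

lemma jacobiSym_seventeen_eq_neg_one {t u e : ℤ} (h : t ^ 2 - 17 * u ^ 2 = -1) (ht : t % 4 = 0)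
    (hu4 : u % 4 = 1) (hu5 : u % 5 = 0) (hu : 0 < u) (he : e = 1 ∨ e = -1) {Q : ℕ}
    (hQ : (Q : ℤ) = 68 * u ^ 2 - 1) : J(1 - 2 * (e * (2 * t * u)) | Q) = -1 := by
  have he2 : e ^ 2 = 1 := by rcases he with rfl | rfl <;> norm_num
  have hvpos : 0 < 17 * u - e * t := by
    have : |e * t| < 17 * u := abs_lt_of_sq_lt_sq (by rw [mul_pow, he2]; nlinarith) (by positivity)
    linarith [le_abs_self (e * t)]
  obtain ⟨v, hv⟩ := Int.eq_ofNat_of_zero_le hvpos.le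
  obtain ⟨m, hm⟩ := Int.eq_ofNat_of_zero_le hu.le
  have hv4 : v % 4 = 1 := by rcases he with rfl | rfl <;> omega
  have hm4 : m % 4 = 1 := by omega
  have hvodd : Odd v := Nat.odd_iff.2 (by omega)
  have hmodd : Odd m := Nat.odd_iff.2 (by omega)
  have hQodd : Odd Q := by
    rw [← Int.odd_coe_nat, hQ]; exact ⟨34 * u ^ 2 - 1, by ring⟩
  have hfact : 1 - 2 * (e * (2 * t * u)) ≡ 2 ^ 2 * m * v [ZMOD Q] := by
    refine Int.modEq_iff_dvd.2 ⟨1, ?_⟩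
    rw [← hv, ← hm, hQ]; ring
  have h2 : J(2 ^ 2 | Q) = 1 := jacobiSym.sq_one' (by
    rw [← Int.isCoprime_iff_gcd_eq_one]
    exact Nat.isCoprime_iff_coprime.2 ((Nat.coprime_two_left).2 hQodd))
  have hmQ : J(m | Q) = 1 := by
    rw [jacobiSym.quadratic_reciprocity_one_mod_four hm4 hQodd]
    have : (Q : ℤ) ≡ -1 [ZMOD m] :=
      (Int.modEq_iff_dvd.2 ⟨68 * u, by rw [hQ, ← hm]; ring⟩).symm
    rw [jacobiSym.mod_left' this, jacobiSym.at_neg_one hmodd, ZMod.χ₄_nat_one_mod_four hm4]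
  have hvQ : J(v | Q) = -1 := by
    have hQv : (Q : ℤ) ≡ (2 * u) ^ 2 * (5 : ℕ) * (17 : ℕ) [ZMOD v] :=
      (Int.modEq_iff_dvd.2 ⟨-(17 * u + e * t), by
        rw [hQ, ← hv]; push_cast; linear_combination (-t ^ 2) * he2 - h⟩).symm
    have hcop : IsCoprime (2 * u) v := by
      refine IsCoprime.mul_left ?_ ?_
      · exact Nat.isCoprime_iff_coprime.2 ((Nat.coprime_two_left).2 hvodd)
      · rw [← hv]
        exact ⟨34 * (17 * u - e * t) - 272 * u, -(17 * u - e * t), by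
          linear_combination -t ^ 2 * he2 - h⟩
    have hv17 : (v : ℤ) % (17 : ℕ) = 4 ∨ (v : ℤ) % (17 : ℕ) = 13 := by
      have h16 : (t % 17) ^ 2 % 17 = 16 := by
        rw [((Int.mod_modEq t 17).pow 2 : _ % _ = _ % _)]
        omega
      have : t % 17 = 4 ∨ t % 17 = 13 := by
        have h1 := Int.emod_nonneg t (by norm_num : (17 : ℤ) ≠ 0)
        have h2 := Int.emod_lt_of_pos t (by norm_num : (0 : ℤ) < 17)
        interval_cases t % 17 <;> simp_all
      rcases he with rfl | rfl <;> omega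
    have hv5 : (v : ℤ) % (5 : ℕ) = 2 ∨ (v : ℤ) % (5 : ℕ) = 3 := by
      have h16 : (t % 5) ^ 2 % 5 = 4 := by
        obtain ⟨c, hc⟩ := Int.dvd_of_emod_eq_zero hu5
        have h1 : t ^ 2 = 5 * (17 * u * c) - 1 := by
          linear_combination h + 17 * u * hc
        rw [((Int.mod_modEq t 5).pow 2 : _ % _ = _ % _), h1]
        omega
      have : t % 5 = 2 ∨ t % 5 = 3 := by
        have h1 := Int.emod_nonneg t (by norm_num : (5 : ℤ) ≠ 0)
        have h2 := Int.emod_lt_of_pos t (by norm_num : (0 : ℤ) < 5)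
        interval_cases t % 5 <;> simp_all
      rcases he with rfl | rfl <;> omega
    have h17 : J(v | 17) = 1 := by
      rw [jacobiSym.mod_left]
      rcases hv17 with h | h <;> rw [h] <;> norm_num
    have h5 : J(v | 5) = -1 := by
      rw [jacobiSym.mod_left]
      rcases hv5 with h | h <;> rw [h] <;> norm_num
    rw [jacobiSym.quadratic_reciprocity_one_mod_four hv4 hQodd, jacobiSym.mod_left' hQv,
      jacobiSym.mul_left, jacobiSym.mul_left,
      jacobiSym.sq_one' (Int.isCoprime_iff_gcd_eq_one.1 hcop),
      jacobiSym.quadratic_reciprocity_one_mod_four (by norm_num) hvodd,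
      jacobiSym.quadratic_reciprocity_one_mod_four (by norm_num) hvodd, h17, h5]
    norm_num
  rw [jacobiSym.mod_left' hfact, jacobiSym.mul_left, jacobiSym.mul_left, h2, hmQ, hvQ]
  norm_num

lemma pell_seventeen_three_dvd {ε : Pell.Solution₁ (17 : ℕ)} (hx : ε.x = 33) (hy : ε.y = 8)
    {k Y : ℤ} (hY : Y ^ 2 = (ε ^ k).x + (1 : ℕ) * (ε ^ k).y) (h3 : 3 ∣ k) : k = 0 := by
  by_contra hk
  obtain ⟨l, rfl⟩ := h3
  obtain ⟨s, n, hn, rfl⟩ := Int.exists_pow_mul_and_not_dvd (k := l) (by rintro rfl; simp at hk)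
    (q := 3) (by norm_num)
  obtain ⟨t, u, hT, hU, htu, ht, hu4, hu5, hu⟩ := pell_seventeen_exists_sqrt hx hy s
  set w := ε ^ (3 * 3 ^ s) with hw
  have hwn : ε ^ (3 * ((3 : ℕ) ^ s * n)) = w ^ n := by
    rw [hw, ← zpow_natCast, ← zpow_mul]
    congr 1; push_cast; ring
  obtain ⟨e, he, h1, h2⟩ := w.zpow_modEq_of_not_three_dvd hn
  have hQw : 2 * w.x + 1 = 68 * u ^ 2 - 1 := by rw [hT]; linear_combination 2 * htu
  obtain ⟨Q, hQ⟩ : ∃ Q : ℕ, 2 * w.x + 1 = Q := Int.eq_ofNat_of_zero_le (by rw [hT]; positivity)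
  have hQ8 : Q % 8 = 3 := by
    obtain ⟨c, hc⟩ : ∃ c, u = 2 * c + 1 := ⟨u / 2, by omega⟩
    have : (Q : ℤ) = 8 * (34 * (c ^ 2 + c) + 8) + 3 := by rw [← hQ, hQw, hc]; ring
    omega
  have hQodd : Odd Q := Nat.odd_iff.2 (by omega)
  have hJ := jacobiSym_seventeen_eq_neg_one htu ht hu4 hu5 hu he (hQ.symm.trans hQw)
  rw [← hU] at hJ
  rw [hQ] at h1 h2
  refine jacobiSym_ne_neg_one_of_sq_modEq (Y := 2 * Y) (z := 2 * (-1 * (1 - 2 * (e * w.y))))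
    (Q := Q) ?_ ?_
  · have h3 : 2 * (2 * w.x + 1) ≡ 0 [ZMOD Q] := by rw [hQ]; simp [Int.ModEq]
    have h4 := ((h1.add (h2.mul_left ((1 : ℕ) : ℤ))).mul_left 4).sub h3.symm
    rw [← hwn, ← hY] at h4
    refine (?_ : (2 * Y) ^ 2 ≡ _ [ZMOD Q]).trans (h4.trans ?_) <;>
    · unfold Int.ModEq; congr 1; push_cast; ring
  · rw [jacobiSym.mul_left, jacobiSym.mul_left, hJ, jacobiSym.at_two hQodd,
      jacobiSym.at_neg_one hQodd, ZMod.χ₄_nat_three_mod_four (by omega),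
      ZMod.χ₈_nat_eq_if_mod_eight]
    simp [hQ8, (by omega : Q % 2 = 1)]

lemma pell_seventeen_eq_zero_or_neg_one {ε : Pell.Solution₁ (17 : ℕ)} (hx : ε.x = 33)
    (hy : ε.y = 8) {k Y : ℤ} (hY : Y ^ 2 = (ε ^ k).x + (1 : ℕ) * (ε ^ k).y) :
    k = 0 ∨ k = -1 := by
  obtain ⟨r, hr⟩ := Int.eq_ofNat_of_zero_le (Int.emod_nonneg k (by norm_num : (72 : ℤ) ≠ 0))
  have hsieve := pellMod_sieve (H := 72) (L := [3, 7, 13, 71]) hx hy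
    (by norm_num) (by decide +kernel) (show k ≡ r [ZMOD (72 : ℕ)] by
      rw [← hr]; exact (Int.mod_modEq k 72).symm) hY
  have hdec : ∀ r < 72, (∀ q ∈ [3, 7, 13, 71], ((pellMod q 17 33 8 r).1 +
      1 * (pellMod q 17 33 8 r).2) ^ ((q - 1) / 2) % q ≠ q - 1) → r % 3 = 0 ∨ r % 36 = 35 := by
    decide +kernel
  rcases hdec r (by omega) hsieve with h | h
  · exact .inl (pell_seventeen_three_dvd hx hy hY (by omega))
  · right
    by_contra hk
    refine false_of_order_four (r := 103) (L := [3, 9]) (by rw [hx]; norm_num) (by rw [hx]; rfl)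
      (by rw [hy]; rfl) hY hk (by decide) (.inr (by
        rw [zpow_neg_one, Pell.Solution₁.x_inv, Pell.Solution₁.y_inv, hx, hy]; norm_num)) (by decide)
      (by simp; omega) fun s ↦ ?_
    have hmem := x_pow_mod_mem (ε := ε) (m := 103)
      (L := [82, 57, 8, 24, 18, 29, 33, 14]) (by
        rw [show ε ^ 4 = (ε ^ 2) ^ 2 from pow_mul _ 2 2]
        simp only [Pell.Solution₁.x_sq, hx]
        decide) (by decide) s
    have hJ : ∀ c ∈ ([82, 57, 8, 24, 18, 29, 33, 14] : List ℤ),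
        J(4 * c ^ 3 - 3 * c | 103) = -1 ∨ J(4 * (4 * c ^ 3 - 3 * c) ^ 3 -
          3 * (4 * c ^ 3 - 3 * c) | 103) = -1 := by
      simp only [List.forall_mem_cons, List.not_mem_nil, IsEmpty.forall_iff, implies_true, and_true]
      norm_num
    have h3 := Pell.Solution₁.x_pow_three_modEq (Int.mod_modEq (ε ^ (4 * 2 ^ s)).x 103).symm
    rcases hJ _ hmem with h | h
    · exact ⟨3, by simp, by rw [pow_mul, ← h]; exact jacobiSym.mod_left' h3⟩
    · refine ⟨9, by simp, ?_⟩
      rw [pow_mul, show (9 : ℕ) = 3 * 3 from rfl, pow_mul, ← h]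
      exact jacobiSym.mod_left' (Pell.Solution₁.x_pow_three_modEq h3)

end PellPowers

lemma exists_sq_eq_zpow {D a T U : ℕ} {b t u Y : ℤ} (hD : (D : ℤ) = a ^ 2 + b ^ 2) (hD0 : 0 < D)
    (hTU : (T : ℤ) ^ 2 - D * (U : ℤ) ^ 2 = 1) (hU0 : 0 < U)
    (hmin : ∀ y < U, y ≠ 0 → Nat.sqrt (D * y ^ 2 + 1) ^ 2 ≠ D * y ^ 2 + 1)
    (htu : t ^ 2 - D * u ^ 2 = 1 ∨ t ^ 2 - D * u ^ 2 = -1)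
    (hY : Y ^ 2 = (t + u * a) ^ 2 + (b * u) ^ 2) :
    ∃ (ε : Pell.Solution₁ (D : ℤ)) (k : ℤ), ε.x = T ∧ ε.y = U ∧
      Y ^ 2 = (ε ^ k).x + a * (ε ^ k).y := by
  have hε := isFundamental_of_forall (ε := Pell.Solution₁.mk (T : ℤ) (U : ℤ) hTU) hD0
    (Pell.Solution₁.x_mk ..) (Pell.Solution₁.y_mk ..) hU0 hmin
  have hpos : 0 < t ^ 2 + D * u ^ 2 := by
    have : (0 : ℤ) < D := by exact_mod_cast hD0
    by_contra! h
    have h1 : 0 ≤ D * u ^ 2 := by positivity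
    have h2 : D * u ^ 2 = 0 := by nlinarith
    have h3 : t ^ 2 = 0 := by nlinarith
    omega
  obtain ⟨k, hx, hy⟩ := Pell.Solution₁.exists_zpow_eq hε (T := t ^ 2 + D * u ^ 2) (U := 2 * t * u)
    (by rcases htu with h | h
        · linear_combination (t ^ 2 - D * u ^ 2 + 1) * h
        · linear_combination (t ^ 2 - D * u ^ 2 - 1) * h) hpos
  refine ⟨Pell.Solution₁.mk (T : ℤ) (U : ℤ) hTU, k, Pell.Solution₁.x_mk .., Pell.Solution₁.y_mk .., ?_⟩
  rw [hx, hy, hY]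
  linear_combination -u ^ 2 * hD

lemma exists_eq_one_or_eq_of_exceptional {a b D : ℤ}
    (hab : a = 1 ∧ b = 3 ∨ a = 11 ∧ b = 7 ∨ a = 1 ∧ b = 4) (hD : D = a ^ 2 + b ^ 2) :
    ∃ Y₀ : ℤ, ∀ t u Y : ℤ, 0 < Y → (t ^ 2 - D * u ^ 2 = 1 ∨ t ^ 2 - D * u ^ 2 = -1) →
      Y ^ 2 = (t + u * a) ^ 2 + (b * u) ^ 2 → Y = 1 ∨ Y = Y₀ := by
  have key : ∀ Y Z : ℤ, 0 < Y → 0 < Z → Y ^ 2 = Z ^ 2 → Y = Z := fun Y Z hY hZ h ↦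
    (pow_left_inj₀ hY.le hZ.le two_ne_zero).1 h
  rcases hab with ⟨rfl, rfl⟩ | ⟨rfl, rfl⟩ | ⟨rfl, rfl⟩
  · obtain rfl : D = (10 : ℕ) := by rw [hD]; norm_num
    refine ⟨5, fun t u Y hY0 htu hY ↦ ?_⟩
    obtain ⟨ε, k, hx, hy, h⟩ := exists_sq_eq_zpow (D := 10) (a := 1) (T := 19) (U := 6) (b := 3)
      (by norm_num) (by norm_num) (by norm_num) (by norm_num) (by decide +kernel) htu
      (by exact_mod_cast hY)
    rcases pell_ten_eq_zero_or_one hx hy h with rfl | rfl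
    · exact .inl (key Y 1 hY0 (by norm_num) (by rw [h]; simp))
    · exact .inr (key Y 5 hY0 (by norm_num) (by rw [h]; simp [hx, hy]))
  · obtain rfl : D = (170 : ℕ) := by rw [hD]; norm_num
    refine ⟨25, fun t u Y hY0 htu hY ↦ ?_⟩
    obtain ⟨ε, k, hx, hy, h⟩ := exists_sq_eq_zpow (D := 170) (a := 11) (T := 339) (U := 26) (b := 7)
      (by norm_num) (by norm_num) (by norm_num) (by norm_num) (by decide +kernel) htu
      (by exact_mod_cast hY)
    rcases pell_one_hundred_seventy_eq_zero_or_one hx hy h with rfl | rfl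
    · exact .inl (key Y 1 hY0 (by norm_num) (by rw [h]; simp))
    · exact .inr (key Y 25 hY0 (by norm_num) (by rw [h]; simp [hx, hy]))
  · obtain rfl : D = (17 : ℕ) := by rw [hD]; norm_num
    refine ⟨5, fun t u Y hY0 htu hY ↦ ?_⟩
    obtain ⟨ε, k, hx, hy, h⟩ := exists_sq_eq_zpow (D := 17) (a := 1) (T := 33) (U := 8) (b := 4)
      (by norm_num) (by norm_num) (by norm_num) (by norm_num) (by decide +kernel) htu
      (by exact_mod_cast hY)
    rcases pell_seventeen_eq_zero_or_neg_one hx hy h with rfl | rfl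
    · exact .inl (key Y 1 hY0 (by norm_num) (by rw [h]; simp))
    · exact .inr (key Y 5 hY0 (by norm_num) (by
        rw [h, zpow_neg_one, Pell.Solution₁.x_inv, Pell.Solution₁.y_inv, hx, hy]; norm_num))

lemma encard_coprime_solutions_le_two {a b D : ℤ} {p m : ℕ} (ha : 0 < a) (hp : p.Prime)
    (hbp : b = (p : ℤ) ^ m) (hcop : IsCoprime a b) (hD : D = a ^ 2 + b ^ 2) (hDsq : ¬ IsSquare D)
    {x y : ℤ} (hneg : x ^ 2 - D * y ^ 2 = -1) :
    {XY : ℤ × ℤ | 0 < XY.1 ∧ 0 < XY.2 ∧ IsCoprime XY.1 XY.2 ∧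
      XY.1 ^ 2 - D * XY.2 ^ 4 = -b ^ 2}.encard ≤ 2 := by
  have hb0 : 0 < b := by rw [hbp]; exact pow_pos (by exact_mod_cast hp.pos) m
  have hb2 : (p : ℤ) ^ (2 * m) = b ^ 2 := by rw [hbp, ← pow_mul, mul_comm]
  have hdvd : ∀ X Y : ℤ, IsCoprime X Y → X ^ 2 - D * Y ^ 4 = -b ^ 2 →
      b ^ 2 ∣ X - a * Y ^ 2 ∨ b ^ 2 ∣ X + a * Y ^ 2 := fun X Y hXY h ↦ by
    rw [hbp]
    refine sq_dvd_sub_or_add hp ?_ hXY (by rw [hb2, ← hD, h])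
    have := Int.isCoprime_iff_gcd_eq_one.1 hcop
    rwa [hbp, Int.gcd, Int.natAbs_pow, Int.natAbs_natCast] at this
  set S := {XY : ℤ × ℤ | 0 < XY.1 ∧ 0 < XY.2 ∧ IsCoprime XY.1 XY.2 ∧
      XY.1 ^ 2 - D * XY.2 ^ 4 = -b ^ 2} with hS
  have hparam : ∀ XY ∈ S, _ := fun XY (h : _ ∧ _ ∧ _ ∧ _) ↦
    exists_pell_param ha hb0 hD hDsq hneg h.2.1 h.2.2.2 (hdvd _ _ h.2.2.1 h.2.2.2)
  suffices h : ∃ Y₀ : ℤ, ∀ XY ∈ S, XY.2 = 1 ∨ XY.2 = Y₀ by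
    obtain ⟨Y₀, hY₀⟩ := h
    have hinj : Set.InjOn Prod.snd S := by
      rintro ⟨X, Y⟩ h ⟨X', Y'⟩ h' rfl
      obtain rfl : X = X' := (pow_left_inj₀ h.1.le h'.1.le two_ne_zero).1
        (by linarith [h.2.2.2, h'.2.2.2])
      rfl
    rw [← hinj.encard_image]
    refine (Set.encard_le_encard (t := {1, Y₀}) ?_).trans
      ((Set.encard_insert_le _ _).trans (by rw [Set.encard_singleton, one_add_one_eq_two]))
    rintro _ ⟨XY, h, rfl⟩
    exact hY₀ XY h
  by_cases hab : (a : ℤ) = 1 ∧ b = 3 ∨ (a : ℤ) = 11 ∧ b = 7 ∨ (a : ℤ) = 1 ∧ b = 4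
  · obtain ⟨Y₀, h⟩ := exists_eq_one_or_eq_of_exceptional hab hD
    refine ⟨Y₀, fun XY hXY ↦ ?_⟩
    obtain ⟨t, u, htu, hY, -⟩ := hparam XY hXY
    exact h t u _ hXY.2.1 htu hY
  have hne : ∀ XY ∈ S, ∀ XY' ∈ S, 1 < XY.2 → ¬ XY.2 < XY'.2 := by
    intro XY h XY' h' h1 hlt
    obtain ⟨t, u, htu, hY, hX⟩ := hparam XY h
    obtain ⟨t', u', htu', hY', hX'⟩ := hparam XY' h'
    have hlarge := (size_or_exceptional hp hbp ha hcop hD hDsq hneg h1 htu hY).resolve_right hab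
    obtain ⟨β, σ, w, hβ, hσ, hw, hform⟩ := exists_fourth_power_form hD h.2.1 h.2.2.1 htu hY hX
    obtain ⟨β', σ', w', hβ', hσ', hw', hform'⟩ :=
      exists_fourth_power_form hD h'.2.1 h'.2.2.1 htu' hY' hX'
    exact false_of_two_fourth_power_forms hb0 hD h.1 h'.1 hβ hβ' hσ hw hw' hform hform'
      h.2.2.2 h'.2.2.2 h1.le hlt hlarge
  by_cases hex : ∃ XY ∈ S, 1 < XY.2
  · obtain ⟨XY, h, h1⟩ := hex
    refine ⟨XY.2, fun XY' h' ↦ ?_⟩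
    by_contra! hXY
    have h1' : 1 < XY'.2 := lt_of_le_of_ne h'.2.1 (Ne.symm hXY.1)
    rcases lt_or_gt_of_ne hXY.2 with hlt | hlt
    · exact hne XY' h' XY h h1' hlt
    · exact hne XY h XY' h' h1 hlt
  · push Not at hex
    exact ⟨1, fun XY h ↦ .inl (le_antisymm (hex XY h) h.2.1)⟩

/-- Theorem 1.1: Let `a` be a positive integer, `m` a non-negative integer and `p` a prime
such that `gcd(a, p^m) = 1` and `a² + p^(2m)` is not a perfect square. Suppose the negative
Pell equation `x² − (a² + p^(2m))·y² = −1` has an integer solution. Then the equation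
`X² − (a² + p^(2m))·Y⁴ = −p^(2m)` has at most two solutions in coprime positive integers. -/
theorem at_most_two_coprime_solutions
    (a m p : ℕ) (ha : 0 < a) (hp : p.Prime)
    (hgcd : Nat.gcd a (p ^ m) = 1)
    (hnotsq : ¬ IsSquare ((a : ℤ) ^ 2 + (p : ℤ) ^ (2 * m)))
    (hpell : ∃ x y : ℤ, x ^ 2 - ((a : ℤ) ^ 2 + (p : ℤ) ^ (2 * m)) * y ^ 2 = -1) :
    {XY : ℤ × ℤ | 0 < XY.1 ∧ 0 < XY.2 ∧ IsCoprime XY.1 XY.2 ∧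
      XY.1 ^ 2 - ((a : ℤ) ^ 2 + (p : ℤ) ^ (2 * m)) * XY.2 ^ 4
        = -((p : ℤ) ^ (2 * m))}.encard ≤ 2 := by
  have hpow : (p : ℤ) ^ (2 * m) = ((p : ℤ) ^ m) ^ 2 := by rw [← pow_mul, mul_comm]
  rw [hpow] at hnotsq hpell ⊢
  obtain ⟨x, y, hneg⟩ := hpell
  exact encard_coprime_solutions_le_two (by exact_mod_cast ha) hp rfl
    (by exact_mod_cast Nat.isCoprime_iff_coprime.2 hgcd) rfl hnotsq hneg
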